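/- arXiv:1211.0814 — 5 statements merged into one kernel-verified Lean document; each statement's English description precedes it below -/
import Mathlib

section
/- In local coordinates, the higher Roytenberg bracket of coordinate vector fields and of coordinate p-forms with coordinate vector fields is given by the structure functions: [∂_k, ∂_l]_R = F_{kl}{}^m ∂_m + H_{klL} dy^L and [∂_k, dy^J]_R = Q_k{}^{mJ} ∂_m + D_k{}^J{}_L dy^L, where F_{kl}{}^m = H_{klJ} Π^{mJ}, Q_k{}^{mJ} = −∂_k Π^{mJ} + H_{lkL} Π^{lJ} Π^{mL}, and D_k{}^J{}_L = H_{lkL} Π^{lJ} (summation over repeated indices, with multi-indices running over strictly ordered p-tuples). -/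
/-!
We formalize the differential geometry over the model space `ℝⁿ` with its global
coordinates.  A differential `p`-form is represented by its fully antisymmetric,
smooth component array `Tens n p`, a `p`-vector field likewise by its
(contravariant) component array, and a vector field by its components.
Throughout, writing `p = q + 1` encodes the hypothesis `p ≥ 1`.
-/

open scoped BigOperators

noncomputable section

/-- Points of the model space `ℝⁿ`. -/
abbrev Pt (n : ℕ) := Fin n → ℝ

/-- Partial derivative along the `j`-th coordinate direction. -/
def pd {n : ℕ} (j : Fin n) (f : Pt n → ℝ) (x : Pt n) : ℝ :=
  fderiv ℝ f x (Pi.single j 1)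

/-- Vector fields on `ℝⁿ` (in components). -/
abbrev VF (n : ℕ) := Pt n → Pt n

/-- Degree-`p` component arrays (covariant for differential forms,
contravariant for multivector fields). -/
abbrev Tens (n p : ℕ) := Pt n → (Fin p → Fin n) → ℝ

/-- All components are smooth functions. -/
def SmoothT {n p : ℕ} (T : Tens n p) : Prop :=
  ∀ a, ContDiff ℝ (⊤ : ℕ∞) fun x => T x a

/-- The component array is fully antisymmetric. -/
def AltT {n p : ℕ} (T : Tens n p) : Prop :=
  ∀ (x : Pt n) (a : Fin p → Fin n) (σ : Equiv.Perm (Fin p)),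
    T x (a ∘ σ) = ((Equiv.Perm.sign σ : ℤ) : ℝ) * T x a

/-- Lie bracket of vector fields: `[V,W] = (V·∇)W − (W·∇)V`. -/
def lieB {n : ℕ} (V W : VF n) : VF n :=
  fun x => fderiv ℝ W x (V x) - fderiv ℝ V x (W x)

/-- Interior product `i_V ω` of a vector field with a `(p+1)`-form. -/
def iV {n p : ℕ} (V : VF n) (ω : Tens n (p + 1)) : Tens n p :=
  fun x a => ∑ j, V x j * ω x (Fin.cons j a)

/-- Exterior derivative of a `p`-form:
`(dω)_{a₀…a_p} = ∑ᵢ (−1)ⁱ ∂_{aᵢ} ω_{a₀…âᵢ…a_p}`. -/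
def dT {n p : ℕ} (ω : Tens n p) : Tens n (p + 1) :=
  fun x a => ∑ i : Fin (p + 1),
    (-1 : ℝ) ^ (i : ℕ) * pd (a i) (fun y => ω y (i.removeNth a)) x

/-- Lie derivative of a `p`-form along a vector field:
`(L_V ω)_a = V^j ∂_j ω_a + ∑ᵣ (∂_{aᵣ} V^j) ω_{a[r↦j]}`. -/
def lieDF {n p : ℕ} (V : VF n) (ω : Tens n p) : Tens n p :=
  fun x a => fderiv ℝ (fun y => ω y a) x (V x)
    + ∑ r : Fin p, ∑ j, pd (a r) (fun y => V y j) x * ω x (Function.update a r j)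

/-- Lie derivative of a `p`-vector field along a vector field:
`(L_V T)^a = V^j ∂_j T^a − ∑ᵣ (∂_j V^{aᵣ}) T^{a[r↦j]}`. -/
def lieDV {n p : ℕ} (V : VF n) (T : Tens n p) : Tens n p :=
  fun x a => fderiv ℝ (fun y => T y a) x (V x)
    - ∑ r : Fin p, ∑ j, pd j (fun y => V y (a r)) x * T x (Function.update a r j)

/-- The map `Π^# : Ωᵖ(M) → 𝔛(M)` induced by a `(p+1)`-vector field `Π`, i.e.
`Π^#(ξ) = (−1)ᵖ i_ξ Π`; in components `Π^#(ξ)^i = ξ_K Π^{iK}` (sum over strictly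
ordered multi-indices `K`, hence the factor `1/p!` for the sum over all tuples). -/
def sharp {n p : ℕ} (P : Tens n (p + 1)) (ξ : Tens n p) : VF n :=
  fun x i => (p.factorial : ℝ)⁻¹ * ∑ K : Fin p → Fin n, ξ x K * P x (Fin.cons i K)

/-- Sections `V + ξ` of `E = TM ⊕ ΛᵖT*M`, with `p = q + 1`. -/
abbrev Sec (n q : ℕ) := VF n × Tens n (q + 1)

/-- `e = V + ξ` is a section of `E`: `V` a smooth vector field,
`ξ` a smooth `p`-form. -/
structure IsSec {n q : ℕ} (e : Sec n q) : Prop where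
  smoothV : ContDiff ℝ (⊤ : ℕ∞) e.1
  smoothF : SmoothT e.2
  altF : AltT e.2

/-- The pairing `⟨V+ξ, W+η⟩ = i_V η + i_W ξ ∈ Ω^{p−1}(M)`. -/
def pairD {n q : ℕ} (e₁ e₂ : Sec n q) : Tens n q :=
  iV e₁.1 e₂.2 + iV e₂.1 e₁.2

/-- The higher Dorfman bracket `[V+ξ, W+η]_D = [V,W] + L_V η − i_W dξ`. -/
def dorf {n q : ℕ} (e₁ e₂ : Sec n q) : Sec n q :=
  (lieB e₁.1 e₂.1, lieDF e₁.1 e₂.2 - iV e₂.1 (dT e₁.2))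

/-- The anchor map of the higher Roytenberg bracket: `ρ(V+ξ) = V − Π^#(ξ)`,
for a `(p+1)`-vector field `Π` (here `p = q + 1`). -/
def rhoR {n q : ℕ} (P : Tens n (q + 2)) (e : Sec n q) : VF n :=
  e.1 - sharp P e.2

/-- The twisted inclusion `j(ξ) = ξ + Π^#(ξ)`. -/
def jR {n q : ℕ} (P : Tens n (q + 2)) (ξ : Tens n (q + 1)) : Sec n q :=
  (sharp P ξ, ξ)

/-- The twisted pairing `⟨e₁,e₂⟩_R = i_{ρ(e₁)}(pr₂ e₂) + i_{ρ(e₂)}(pr₂ e₁)`. -/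
def pairR {n q : ℕ} (P : Tens n (q + 2)) (e₁ e₂ : Sec n q) : Tens n q :=
  iV (rhoR P e₁) e₂.2 + iV (rhoR P e₂) e₁.2

/-- The higher Roytenberg bracket, twisted by the `(p+1)`-vector `Π` and the
`(p+2)`-form `H`:
`[e₁,e₂]_R = [ρ(e₁),ρ(e₂)] + j(L_{ρ(e₁)}(pr₂ e₂) − i_{ρ(e₂)} d(pr₂ e₁) + i_{ρ(e₂)} i_{ρ(e₁)} H)`. -/
def royt {n q : ℕ} (P : Tens n (q + 2)) (H : Tens n (q + 3))
    (e₁ e₂ : Sec n q) : Sec n q :=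
  (lieB (rhoR P e₁) (rhoR P e₂), 0) +
    jR P (lieDF (rhoR P e₁) e₂.2 - iV (rhoR P e₂) (dT e₁.2)
      + iV (rhoR P e₂) (iV (rhoR P e₁) H))

/-- The coordinate vector field `∂ₖ`. -/
def coordVF {n : ℕ} (k : Fin n) : VF n := fun _ => Pi.single k 1

/-- The generalized Kronecker delta `δ^J_a` of two multi-indices. -/
def gdelta {n p : ℕ} (J a : Fin p → Fin n) : ℝ :=
  ∑ σ : Equiv.Perm (Fin p), ((Equiv.Perm.sign σ : ℤ) : ℝ) * (if a = J ∘ σ then 1 else 0)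

/-- The coordinate `p`-form `dy^J = dy^{j₁} ∧ ⋯ ∧ dy^{j_p}` (in components,
the generalized Kronecker delta). -/
def dyF {n p : ℕ} (J : Fin p → Fin n) : Tens n p := fun _ a => gdelta J a

/-- The section `∂ₖ + 0` of `E`. -/
def coordSec {n q : ℕ} (k : Fin n) : Sec n q := (coordVF k, 0)

/-- The section `0 + dy^J` of `E`. -/
def dySec {n q : ℕ} (J : Fin (q + 1) → Fin n) : Sec n q := (0, dyF J)

theorem aux_sharp_zero {n p : ℕ} (P : Tens n (p + 1)) : sharp P 0 = 0 := by
  funext x i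
  simp [sharp]

theorem aux_sharp_dy {n p : ℕ} (P : Tens n (p + 1)) (hPa : AltT P)
    (J : Fin p → Fin n) : sharp P (dyF J) = fun x i => P x (Fin.cons i J) := by
  funext x i
  have key : ∀ σ : Equiv.Perm (Fin p),
      P x (Fin.cons i (J ∘ σ)) = ((Equiv.Perm.sign σ : ℤ) : ℝ) * P x (Fin.cons i J) := by
    intro σ
    have h := hPa x (Fin.cons i J) (Equiv.Perm.decomposeFin.symm (0, σ))
    rw [Equiv.Perm.decomposeFin.symm_sign] at h
    simp only [if_true, one_mul] at h
    rw [← h]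
    congr 1
    funext r
    refine Fin.cases ?_ (fun r => ?_) r
    · simp
    · simp
  have : ∑ K : Fin p → Fin n, dyF J x K * P x (Fin.cons i K)
      = (p.factorial : ℝ) * P x (Fin.cons i J) := by
    simp only [dyF, gdelta, Finset.sum_mul]
    rw [Finset.sum_comm]
    have h2 : ∀ σ : Equiv.Perm (Fin p),
        ∑ K : Fin p → Fin n, ((Equiv.Perm.sign σ : ℤ) : ℝ) * (if K = J ∘ σ then 1 else 0)
          * P x (Fin.cons i K) = P x (Fin.cons i J) := by
      intro σ
      simp only [mul_ite, mul_one, mul_zero, ite_mul, zero_mul, Finset.sum_ite_eq',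
        Finset.mem_univ, if_true]
      rw [key, ← mul_assoc]
      have : ((Equiv.Perm.sign σ : ℤ) : ℝ) * ((Equiv.Perm.sign σ : ℤ) : ℝ) = 1 := by
        rcases Int.units_eq_one_or (Equiv.Perm.sign σ) with h | h <;> simp [h]
      rw [this, one_mul]
    rw [Finset.sum_congr rfl (fun σ _ => h2 σ)]
    simp [Finset.card_univ, Fintype.card_perm]
  simp only [sharp]
  rw [this, ← mul_assoc, inv_mul_cancel₀ (by positivity), one_mul]

theorem aux_fderiv_coord {n : ℕ} (k : Fin n) (x : Pt n) : fderiv ℝ (coordVF k) x = 0 :=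
  fderiv_const_apply _

theorem aux_rho_coord {n q : ℕ} (P : Tens n (q + 2)) (k : Fin n) :
    rhoR P (coordSec k) = coordVF k := by
  simp [rhoR, coordSec, aux_sharp_zero]

theorem aux_rho_dy {n q : ℕ} (P : Tens n (q + 2)) (hPa : AltT P) (J : Fin (q + 1) → Fin n) :
    rhoR P (dySec J) = fun x i => - P x (Fin.cons i J) := by
  funext x i
  simp [rhoR, dySec, aux_sharp_dy P hPa]

theorem aux_dT_zero {n p : ℕ} : dT (0 : Tens n p) = 0 := by
  funext x a
  simp [dT, pd]

theorem aux_iV_zero {n p : ℕ} (V : VF n) : iV V (0 : Tens n (p + 1)) = 0 := by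
  funext x a
  simp [iV]

theorem aux_iV_coord {n p : ℕ} (k : Fin n) (ω : Tens n (p + 1)) :
    iV (coordVF k) ω = fun x a => ω x (Fin.cons k a) := by
  funext x a
  simp [iV, coordVF, Pi.single_apply]

theorem aux_lieDF_const {n p : ℕ} (k : Fin n) (c : (Fin p → Fin n) → ℝ) :
    lieDF (coordVF k) (fun _ => c) = 0 := by
  funext x a
  simp [lieDF, coordVF, pd]

theorem aux_swap {n p : ℕ} (H : Tens n (p + 2)) (hHa : AltT H) (x : Pt n) (k l : Fin n)
    (a : Fin p → Fin n) :
    H x (Fin.cons k (Fin.cons l a)) = - H x (Fin.cons l (Fin.cons k a)) := by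
  have h := hHa x (Fin.cons l (Fin.cons k a)) (Equiv.swap 0 1)
  rw [Equiv.Perm.sign_swap (by simp)] at h
  have e : (Fin.cons l (Fin.cons k a) : Fin (p + 2) → Fin n) ∘ (Equiv.swap 0 1)
      = Fin.cons k (Fin.cons l a) := by
    funext r
    refine Fin.cases ?_ (fun r => Fin.cases ?_ (fun r => ?_) r) r
    · simp only [Function.comp, Equiv.swap_apply_left]; rfl
    · have : (Fin.succ 0 : Fin (p + 2)) = 1 := rfl
      simp only [Function.comp, this, Equiv.swap_apply_right]; rfl
    · have h0 : (r.succ.succ : Fin (p + 2)) ≠ 0 := Fin.succ_ne_zero _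
      have h1 : (r.succ.succ : Fin (p + 2)) ≠ 1 := by
        intro h
        exact Fin.succ_ne_zero r (Fin.succ_injective _ h)
      simp only [Function.comp, Equiv.swap_apply_of_ne_of_ne h0 h1, Fin.cons_succ]
  rw [e] at h
  simpa using h

/-- In local coordinates the higher Roytenberg bracket of
coordinate vector fields, and of coordinate vector fields with coordinate
`p`-forms, is given by the structure functions
`[∂ₖ,∂ₗ]_R = F_{kl}{}^m ∂ₘ + H_{klL} dy^L` and
`[∂ₖ,dy^J]_R = Q_k{}^{mJ} ∂ₘ + D_k{}^J{}_L dy^L`, where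
`F_{kl}{}^m = H_{klJ} Π^{mJ}`, `Q_k{}^{mJ} = −∂ₖ Π^{mJ} + H_{lkL} Π^{lJ} Π^{mL}`,
`D_k{}^J{}_L = H_{lkL} Π^{lJ}`.  (Sums over ordered multi-indices are written as
sums over all tuples divided by `p!`; the form `H_{klL} dy^L` resp.
`D_k{}^J{}_L dy^L` is recorded by its fully antisymmetric component array;
here `p = q + 1`.) -/
theorem higher_roytenberg_structure_functions_vector_part {n q : ℕ}
    (P : Tens n (q + 2)) (hPs : SmoothT P) (hPa : AltT P)
    (H : Tens n (q + 3)) (hHs : SmoothT H) (hHa : AltT H) (hHcl : dT H = 0)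
    (k l : Fin n) (J : Fin (q + 1) → Fin n) (hJ : StrictMono J) :
    royt P H (coordSec k) (coordSec l) =
      ((fun x m => ((q + 1).factorial : ℝ)⁻¹ *
          ∑ L : Fin (q + 1) → Fin n,
            H x (Fin.cons k (Fin.cons l L)) * P x (Fin.cons m L)),
        fun x a => H x (Fin.cons k (Fin.cons l a)))
    ∧ royt P H (coordSec k) (dySec J) =
      ((fun x m => - pd k (fun y => P y (Fin.cons m J)) x
          + ((q + 1).factorial : ℝ)⁻¹ *
            ∑ l' : Fin n, ∑ L : Fin (q + 1) → Fin n,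
              H x (Fin.cons l' (Fin.cons k L)) * P x (Fin.cons l' J)
                * P x (Fin.cons m L)),
        fun x a => ∑ l' : Fin n,
          H x (Fin.cons l' (Fin.cons k a)) * P x (Fin.cons l' J)) := by
  have hz : ∀ k : Fin n, (coordSec k : Sec n q).2 = 0 := fun _ => rfl
  constructor
  · have h0 : lieDF (coordVF k) (0 : Tens n (q + 1)) = 0 := aux_lieDF_const k 0
    unfold royt
    rw [aux_rho_coord, aux_rho_coord, hz, hz, aux_dT_zero, aux_iV_zero, h0, aux_iV_coord,
      aux_iV_coord]
    refine Prod.ext ?_ ?_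
    · funext x m
      simp [jR, sharp, lieB, aux_fderiv_coord]
    · funext x a
      simp [jR]
  · have h0 : lieDF (coordVF k) (dyF J) = 0 := aux_lieDF_const k _
    have h1 : (dySec J : Sec n q).2 = dyF J := rfl
    have hi : iV (fun x i => - P x (Fin.cons i J)) (iV (coordVF k) H)
        = fun x a => ∑ l' : Fin n,
          H x (Fin.cons l' (Fin.cons k a)) * P x (Fin.cons l' J) := by
      rw [aux_iV_coord]
      funext x a
      simp only [iV]
      refine Finset.sum_congr rfl fun l' _ => ?_
      rw [aux_swap H hHa x k l' a]
      ring
    unfold royt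
    rw [aux_rho_coord, aux_rho_dy P hPa, hz, h1, aux_dT_zero, aux_iV_zero, h0, hi]
    have hd : ∀ (x : Pt n) (i : Fin n),
        DifferentiableAt ℝ (fun y => - P y (Fin.cons i J)) x := fun x i =>
      (((hPs (Fin.cons i J)).differentiable (by simp)) x).neg
    refine Prod.ext ?_ ?_
    · funext x m
      have hl : lieB (coordVF k) (fun x i => - P x (Fin.cons i J)) x m
          = - pd k (fun y => P y (Fin.cons m J)) x := by
        simp only [lieB, Pi.sub_apply]
        rw [fderiv_pi (fun i => hd x i), aux_fderiv_coord]
        simp [coordVF, pd, fderiv_fun_neg]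
      simp only [Prod.fst_add, Pi.add_apply, hl, jR, sharp, sub_zero, zero_add]
      congr 2
      rw [Finset.sum_comm]
      refine Finset.sum_congr rfl fun L _ => ?_
      rw [Finset.sum_mul]
    · funext x a
      simp [jR]
end
end

section
/- A smooth (p+1)-vector field Π on M satisfies the fundamental identity (i.e., is a Nambu–Poisson structure) if and only if for every p-form ξ ∈ Ωᵖ(M) one has L_{Π^#(ξ)}(Π) = −( i_{dξ}(Π)·Π − (1/(p+1))·i_{dξ}(Π ∧ Π) ), where i_{dξ}(Π) denotes the full contraction of the (p+1)-form dξ with the (p+1)-vector Π (a smooth function) and i_{dξ}(Π ∧ Π) the contraction of dξ with the (2p+2)-vector Π ∧ Π (a (p+1)-vector field). -/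
/-!
We formalize the differential geometry over the model space `ℝⁿ` with its global
coordinates.  A differential `p`-form is represented by its fully antisymmetric,
smooth component array `Tens n p`, a `p`-vector field likewise by its
(contravariant) component array, and a vector field by its components.
Throughout, writing `p = q + 1` encodes the hypothesis `p ≥ 1`.
-/

open scoped BigOperators

noncomputable section

/-- The `p`-form `df₁ ∧ ⋯ ∧ df_p` in components:
`(df₁∧⋯∧df_p)_a = Σ_σ sgn(σ) Π_i ∂_{a(σ i)} f_i`. -/
def dfWedge {n p : ℕ} (f : Fin p → (Pt n → ℝ)) : Tens n p :=
  fun x a => ∑ σ : Equiv.Perm (Fin p),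
    ((Equiv.Perm.sign σ : ℤ) : ℝ) * ∏ i, pd (a (σ i)) (f i) x

/-- The fundamental identity: a `(p+1)`-vector field `Π` is a Nambu–Poisson
structure iff `L_{Π^#(df₁ ∧ ⋯ ∧ df_p)}(Π) = 0` for all smooth functions
`f₁, …, f_p`. -/
def NambuPoisson {n p : ℕ} (P : Tens n (p + 1)) : Prop :=
  ∀ f : Fin p → (Pt n → ℝ), (∀ i, ContDiff ℝ (⊤ : ℕ∞) (f i)) →
    lieDV (sharp P (dfWedge f)) P = 0

/-- The full contraction of a `p`-form with a `p`-vector field (with the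
normalization corresponding to sums over ordered multi-indices). -/
def contrF {n p : ℕ} (ω T : Tens n p) : Pt n → ℝ :=
  fun x => (p.factorial : ℝ)⁻¹ * ∑ A : Fin p → Fin n, ω x A * T x A

/-- The wedge product of multivector fields. -/
def wedgeV {n k l : ℕ} (A : Tens n k) (B : Tens n l) : Tens n (k + l) :=
  fun x a => ((k.factorial * l.factorial : ℕ) : ℝ)⁻¹ *
    ∑ σ : Equiv.Perm (Fin (k + l)), ((Equiv.Perm.sign σ : ℤ) : ℝ) *
      (A x fun i => a (σ (Fin.castAdd l i))) *
      (B x fun i => a (σ (Fin.natAdd k i)))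

/-- Contraction `i_ω T` of a `p`-form into the trailing `p` slots of an
`(m+p)`-vector field, yielding an `m`-vector field. -/
def contrIn {n p m : ℕ} (ω : Tens n p) (T : Tens n (m + p)) : Tens n m :=
  fun x b => (p.factorial : ℝ)⁻¹ *
    ∑ A : Fin p → Fin n, ω x A * T x (Fin.append b A)


/-! ### Pure algebra: decomposability -/

lemma plucker_det {k : ℕ} (A : Matrix (Fin (k+1)) (Fin (k+1)) ℝ) (b : Fin (k+1) → ℝ)
    (L : Fin k → Fin (k+1) → ℝ) :
    ∑ r, Matrix.det (Fin.cons (A r) L : Fin (k+1) → Fin (k+1) → ℝ) * (A.updateRow r b).det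
      = A.det * Matrix.det (Fin.cons b L : Fin (k+1) → Fin (k+1) → ℝ) := by
  have h := Matrix.mulVec_cramer A.transpose b
  have h2 : ∑ r, (A.updateRow r b).det • A r = A.det • b := by
    rw [Matrix.det_transpose] at h
    rw [← h]
    ext j
    simp [Matrix.mulVec, dotProduct, Matrix.cramer_transpose_apply, mul_comm]
  let D := (Matrix.detRowAlternating (n := Fin (k+1)) (R := ℝ)).toMultilinearMap.toLinearMap
    (Fin.cons 0 L : Fin (k+1) → Fin (k+1) → ℝ) 0
  have hD : ∀ v, D v = Matrix.det (Fin.cons v L : Fin (k+1) → Fin (k+1) → ℝ) := by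
    intro v
    simp [D, Matrix.detRowAlternating]
    rfl
  have h3 := congrArg D h2
  rw [map_sum] at h3
  simp only [map_smul, smul_eq_mul] at h3
  simp only [hD] at h3
  refine Eq.trans ?_ h3
  exact Finset.sum_congr rfl fun r _ => mul_comm _ _

lemma map_replace {k : ℕ} {W : Type*} [AddCommGroup W] [Module ℝ W]
    (f : W → W) (g : (Fin k → W) → ℝ) (C : (Fin k → W) → Prop)
    (hC : ∀ w i, C w → C (Function.update w i (f (w i))))
    (h : ∀ w i, C w → g (Function.update w i (f (w i))) = g w)
    (w : Fin k → W) (hw : C w) : g (f ∘ w) = g w := by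
  have key : ∀ s : Finset (Fin k), C (fun i => if i ∈ s then f (w i) else w i) ∧
      g (fun i => if i ∈ s then f (w i) else w i) = g w := by
    intro s
    induction s using Finset.induction_on with
    | empty => simpa using hw
    | insert a s ha ih =>
      have e : (fun i => if i ∈ insert a s then f (w i) else w i)
          = Function.update (fun i => if i ∈ s then f (w i) else w i) a
            (f ((fun i => if i ∈ s then f (w i) else w i) a)) := by
        ext i
        by_cases hi : i = a
        · subst hi; simp [ha]
        · simp [Function.update_of_ne hi, hi]
      rw [e]
      exact ⟨hC _ _ ih.1, by rw [h _ _ ih.1, ih.2]⟩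
  have := (key Finset.univ).2
  simp only [Finset.mem_univ, if_true] at this
  exact this

lemma decomposable {q : ℕ} {W : Type*} [AddCommGroup W] [Module ℝ W]
    (P : W [⋀^Fin (q+1+2)]→ₗ[ℝ] ℝ)
    (hA : ∀ (α : Fin (q+1+2) → W) (β : W) (κ : Fin (q+1) → W),
      ∑ r, P (Fin.cons (α r) (Fin.cons β κ)) * P (Function.update α r β) = 0) :
    ∃ (c : ℝ) (E : W →ₗ[ℝ] (Fin (q+1+2) → ℝ)),
      ∀ w, P w = c * Matrix.det (fun i => E (w i)) := by
  classical
  by_cases hP : ∀ w, P w = 0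
  · exact ⟨0, 0, fun w => by simp [hP]⟩
  push Not at hP
  obtain ⟨x, hx⟩ := hP
  -- polarised identity
  have hA2 : ∀ (α : Fin (q+1+2) → W) (β γ : W) (κ : Fin (q+1) → W),
      ∑ r, P (Fin.cons (α r) (Fin.cons γ κ)) * P (Function.update α r β)
      + ∑ r, P (Fin.cons (α r) (Fin.cons β κ)) * P (Function.update α r γ) = 0 := by
    intro α β γ κ
    have h1 := hA α (β + γ) κ
    have h2 := hA α β κ
    have h3 := hA α γ κ
    have e : ∀ a : W, P (Fin.cons a (Fin.cons (β+γ) κ)) =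
        P (Fin.cons a (Fin.cons β κ)) + P (Fin.cons a (Fin.cons γ κ)) := by
      intro a
      have hu : ∀ z : W, (Fin.cons a (Fin.cons z κ) : Fin (q+1+2) → W) =
          Function.update (Fin.cons a (Fin.cons 0 κ) : Fin (q+1+2) → W) (Fin.succ 0) z := by
        intro z
        rw [← Fin.cons_update, Fin.update_cons_zero]
      rw [hu (β+γ), hu β, hu γ, P.map_update_add]
    simp only [e, P.map_update_add] at h1
    rw [← h1, ← sub_eq_zero, ← Finset.sum_add_distrib, ← Finset.sum_sub_distrib]
    have : ∑ r, (-(P (Fin.cons (α r) (Fin.cons β κ)) * P (Function.update α r β))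
      -(P (Fin.cons (α r) (Fin.cons γ κ)) * P (Function.update α r γ))) = 0 := by
      rw [Finset.sum_sub_distrib, Finset.sum_neg_distrib, h2, h3]; simp
    rw [← this]
    exact Finset.sum_congr rfl fun r _ => by ring
  -- dual functionals
  let e : Fin (q+1+2) → (W →ₗ[ℝ] ℝ) := fun r => (P x)⁻¹ • P.toMultilinearMap.toLinearMap x r
  have he : ∀ r w, e r w = (P x)⁻¹ * P (Function.update x r w) := fun r w => rfl
  have hex : ∀ r s, e r (x s) = if r = s then 1 else 0 := by
    intro r s
    rw [he]
    split_ifs with h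
    · subst h; simp [hx]
    · rw [P.map_update_self x h]; simp
  let ker : W → Prop := fun w => ∀ r, e r w = 0
  have hker : ∀ w, ker w → ∀ r, P (Function.update x r w) = 0 := by
    intro w hw r
    have := hw r
    rw [he] at this
    simpa [hx] using this
  -- mixed terms vanish
  have mix0 : ∀ (s : Fin (q+1+2)) (β : W) (κ : Fin (q+1) → W), ker β →
      P (Fin.cons (x s) (Fin.cons β κ)) = 0 := by
    intro s β κ hβ
    have h := hA2 x β (x s) κ
    simp only [hker β hβ, mul_zero, Finset.sum_const_zero, zero_add] at h
    rw [Finset.sum_eq_single s] at h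
    · simpa [hx] using h
    · intro r _ hr
      rw [P.map_update_self x hr]; simp
    · simp
  have mix : ∀ (w : Fin (q+1+2) → W) (i j : Fin (q+1+2)) (s : Fin (q+1+2)), i ≠ j →
      w i = x s → ker (w j) → P w = 0 := by
    intro w i j s hij hi hj
    obtain ⟨σ, h0, h1⟩ : ∃ σ : Equiv.Perm (Fin (q+1+2)), σ 0 = i ∧ σ 1 = j := by
      refine ⟨(Equiv.swap (Equiv.swap 0 i 1) j) * Equiv.swap 0 i, ?_, ?_⟩
      · simp only [Equiv.Perm.mul_apply, Equiv.swap_apply_left]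
        apply Equiv.swap_apply_of_ne_of_ne
        · intro h
          have : Equiv.swap 0 i (0 : Fin (q+1+2)) = Equiv.swap 0 i 1 := by simpa using h
          exact absurd ((Equiv.swap 0 i).injective this) (by simp [Fin.ext_iff])
        · exact hij
      · simp
    have hp := P.map_perm w σ
    have hz : P (w ∘ σ) = 0 := by
      have : w ∘ σ = Fin.cons (x s) (Fin.cons (w j) (fun k => (w ∘ σ) k.succ.succ)) := by
        ext k
        refine Fin.cases ?_ (fun k => ?_) k
        · simp [h0, hi]
        · refine Fin.cases ?_ (fun k => ?_) k
          · simp [h1]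
          · simp
      rw [this]
      exact mix0 _ _ _ hj
    rw [hz] at hp
    rcases Int.units_eq_one_or (Equiv.Perm.sign σ) with h | h <;> rw [h] at hp
    · simpa using hp.symm
    · simpa using hp.symm
  -- all in the kernel
  have allk : ∀ μ : Fin (q+1+2) → W, (∀ i, ker (μ i)) → P μ = 0 := by
    intro μ hμ
    have h := hA2 (Fin.cons (x 0) (fun i => μ i.succ)) (μ 0) (x 1) (fun k => x k.succ.succ)
    have t2 : ∑ r, P (Fin.cons ((Fin.cons (x 0) (fun i => μ i.succ) : Fin (q+1+2) → W) r)
        (Fin.cons (μ 0) (fun k => x k.succ.succ))) *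
        P (Function.update (Fin.cons (x 0) (fun i => μ i.succ) : Fin (q+1+2) → W) r (x 1)) = 0 := by
      refine Finset.sum_eq_zero fun r _ => ?_
      refine mul_eq_zero_of_left (mix _ (Fin.succ (Fin.succ 0)) (Fin.succ 0) (Fin.succ (Fin.succ 0))
        ?_ ?_ ?_) _
      · exact fun h => Fin.succ_ne_zero _ (Fin.succ_injective _ h)
      · rfl
      · exact hμ 0
    rw [t2, add_zero, Fin.sum_univ_succ] at h
    have t1 : ∀ r : Fin (q+1+1), P (Fin.cons ((Fin.cons (x 0) (fun i => μ i.succ) : Fin (q+1+2) → W) r.succ)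
        (Fin.cons (x 1) (fun k => x k.succ.succ))) = 0 := by
      intro r
      exact mix _ (Fin.succ 0) 0 1 (by simp [Fin.ext_iff]) (by simp) (by simpa using hμ _)
    simp only [t1, zero_mul, Finset.sum_const_zero, add_zero, Fin.cons_zero, Fin.update_cons_zero] at h
    have ex : (Fin.cons (x 0) (Fin.cons (x 1) (fun k => x k.succ.succ)) : Fin (q+1+2) → W) = x := by
      ext k
      refine Fin.cases ?_ (fun k => ?_) k
      · simp
      · refine Fin.cases ?_ (fun k => ?_) k
        · simp
        · simp
    have em : (Fin.cons (μ 0) (fun i => μ i.succ) : Fin (q+1+2) → W) = μ := Fin.cons_self_tail μ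
    rw [ex, em] at h
    exact (mul_eq_zero.mp h).resolve_left hx
  let ρ : W →ₗ[ℝ] W := ∑ s, (e s).smulRight (x s)
  have hρ : ∀ w, ρ w = ∑ s, e s w • x s := by intro w; simp [ρ]
  have hkerρ : ∀ w, ker (w - ρ w) := by
    intro w r
    rw [map_sub, hρ, map_sum]
    simp [hex]
  have hρker : ∀ w, ker w → ρ w = 0 := by
    intro w hw
    rw [hρ]
    exact Finset.sum_eq_zero fun s _ => by rw [hw s, zero_smul]
  -- one in the kernel
  have onek : ∀ (w : Fin (q+1+2) → W) (j), ker (w j) → P w = 0 := by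
    intro w j hj
    rw [← map_replace (fun v => v - ρ v) P (fun w => ker (w j)) ?_ ?_ w hj]
    · exact allk _ fun i => hkerρ _
    · intro w i hw
      by_cases hi : i = j
      · subst hi; simpa using hkerρ _
      · simpa [Function.update_of_ne (Ne.symm hi)] using hw
    · intro w i hw
      by_cases hi : i = j
      · subst hi; simp [hρker _ hw]
      · have : P (Function.update w i (ρ (w i))) = 0 := by
          rw [hρ, P.map_update_sum]
          refine Finset.sum_eq_zero fun s _ => ?_
          rw [P.map_update_smul, mix _ i j s hi (by simp) (by simpa [Function.update_of_ne (Ne.symm hi)] using hw)]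
          simp
        rw [P.map_update_sub, this]; simp
  have hPρ : ∀ w, P w = P (fun i => ρ (w i)) := by
    intro w
    refine (map_replace ρ P (fun _ => True) (fun _ _ _ => trivial) ?_ w trivial).symm
    intro w i _
    have h0 := onek (Function.update w i (w i - ρ (w i))) i (by simpa using hkerρ _)
    rw [P.map_update_sub, Function.update_eq_self] at h0
    linarith
  let L : (Fin (q+1+2) → ℝ) →ₗ[ℝ] W := Fintype.linearCombination ℝ x
  let E : W →ₗ[ℝ] (Fin (q+1+2) → ℝ) := LinearMap.pi e
  refine ⟨P x, E, fun w => ?_⟩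
  have h := (P.compLinearMap L).eq_smul_basis_det (Pi.basisFun ℝ (Fin (q+1+2)))
  have h2 := congrArg (fun g => g (fun i => E (w i))) h
  have hLE : ∀ v, L (E v) = ρ v := by
    intro v; simp [L, E, hρ, Fintype.linearCombination_apply]
  simp only [AlternatingMap.compLinearMap_apply, AlternatingMap.smul_apply, Pi.basisFun_det_apply] at h2
  have hb : (fun i => L (Pi.basisFun ℝ (Fin (q+1+2)) i)) = x := by
    ext i; simp [L, Fintype.linearCombination_apply, Pi.single_apply]
  rw [hPρ w]
  simp only [← hLE]
  refine h2.trans ?_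
  rw [smul_eq_mul]
  congr 1
  exact congrArg P hb

/-! ### Component arrays at a point -/

/-- Pointwise antisymmetry. -/
def Alt1 {n k : ℕ} (T : (Fin k → Fin n) → ℝ) : Prop :=
  ∀ (a : Fin k → Fin n) (σ : Equiv.Perm (Fin k)),
    T (a ∘ σ) = ((Equiv.Perm.sign σ : ℤ) : ℝ) * T a

lemma sign_mul_self_real {k : ℕ} (σ : Equiv.Perm (Fin k)) :
    ((Equiv.Perm.sign σ : ℤ) : ℝ) * ((Equiv.Perm.sign σ : ℤ) : ℝ) = 1 := by
  rcases Int.units_eq_one_or (Equiv.Perm.sign σ) with h | h <;> simp [h]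

/-- multilinear extension -/
def toMul {n k : ℕ} (T : (Fin k → Fin n) → ℝ) :
    MultilinearMap ℝ (fun _ : Fin k => Fin n → ℝ) ℝ :=
  ∑ A : Fin k → Fin n, T A • (MultilinearMap.mkPiAlgebra ℝ (Fin k) ℝ).compLinearMap
    (fun i => LinearMap.proj (A i))

lemma toMul_apply {n k : ℕ} (T : (Fin k → Fin n) → ℝ) (α : Fin k → Fin n → ℝ) :
    toMul T α = ∑ A : Fin k → Fin n, (∏ i, α i (A i)) * T A := by
  simp [toMul, mul_comm]

lemma toMul_perm {n k : ℕ} (T : (Fin k → Fin n) → ℝ) (hT : Alt1 T) (α : Fin k → Fin n → ℝ)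
    (σ : Equiv.Perm (Fin k)) : toMul T (α ∘ σ) = ((Equiv.Perm.sign σ : ℤ) : ℝ) * toMul T α := by
  rw [toMul_apply, toMul_apply, Finset.mul_sum]
  refine Fintype.sum_equiv (Equiv.arrowCongr σ (Equiv.refl _)) _ _ fun A => ?_
  have h : (Equiv.arrowCongr σ (Equiv.refl (Fin n))) A = A ∘ σ.symm := by
    ext; simp [Equiv.arrowCongr]
  have h2 : T A = ((Equiv.Perm.sign σ : ℤ) : ℝ) * T (A ∘ σ.symm) := by
    rw [← hT]; congr 1; ext; simp
  rw [h, h2]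
  have h3 : ∏ i, α i ((A ∘ σ.symm) i) = ∏ i, (α ∘ σ) i (A i) := by
    refine (Fintype.prod_equiv σ _ _ fun i => ?_).symm
    simp
  rw [h3]; ring

/-- alternating extension -/
def toAlt {n k : ℕ} (T : (Fin k → Fin n) → ℝ) (hT : Alt1 T) :
    (Fin n → ℝ) [⋀^Fin k]→ₗ[ℝ] ℝ :=
  { toMul T with
    map_eq_zero_of_eq' := by
      intro v i j hv hij
      have h := toMul_perm T hT v (Equiv.swap i j)
      have : v ∘ Equiv.swap i j = v := by
        ext l
        by_cases hl : l = i
        · subst hl; simp [hv]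
        · by_cases hl2 : l = j
          · subst hl2; simp [hv]
          · simp [Equiv.swap_apply_of_ne_of_ne hl hl2]
      rw [this, Equiv.Perm.sign_swap hij] at h
      have h' : toMul T v = 0 := by
        push_cast at h
        linarith
      exact h' }

lemma toAlt_apply {n k : ℕ} (T : (Fin k → Fin n) → ℝ) (hT : Alt1 T) (α : Fin k → Fin n → ℝ) :
    toAlt T hT α = ∑ A : Fin k → Fin n, (∏ i, α i (A i)) * T A := toMul_apply T α

lemma sum_prod_single {n k : ℕ} (T : (Fin k → Fin n) → ℝ) (a : Fin k → Fin n) :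
    ∑ A : Fin k → Fin n, (∏ i, (Pi.single (a i) (1:ℝ) : Fin n → ℝ) (A i)) * T A = T a := by
  rw [Finset.sum_eq_single a]
  · simp
  · intro A _ hA
    obtain ⟨i, hi⟩ := Function.ne_iff.mp hA
    rw [Finset.prod_eq_zero (Finset.mem_univ i)]
    · simp
    · simp [hi]
  · simp

lemma toAlt_single {n k : ℕ} (T : (Fin k → Fin n) → ℝ) (hT : Alt1 T) (a : Fin k → Fin n) :
    toAlt T hT (fun i => Pi.single (a i) 1) = T a := by
  rw [toAlt_apply, sum_prod_single]

lemma sum_cons {n k : ℕ} (F : (Fin (k+1) → Fin n) → ℝ) :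
    ∑ A, F A = ∑ j, ∑ K : Fin k → Fin n, F (Fin.cons j K) := by
  rw [← Fintype.sum_prod_type']
  exact (Fintype.sum_equiv (Fin.consEquiv (fun _ => Fin n)) _ _ fun p => rfl).symm

lemma sum_insertNth {n k : ℕ} (i : Fin (k+1)) (F : (Fin (k+1) → Fin n) → ℝ) :
    ∑ A, F A = ∑ j, ∑ K : Fin k → Fin n, F (i.insertNth j K) := by
  rw [← Fintype.sum_prod_type']
  exact (Fintype.sum_equiv (Fin.insertNthEquiv (fun _ => Fin n) i) _ _ fun p => rfl).symm

lemma alt_insertNth {n k : ℕ} (T : (Fin (k+1) → Fin n) → ℝ) (hT : Alt1 T) (i : Fin (k+1))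
    (j : Fin n) (K : Fin k → Fin n) :
    T (i.insertNth j K) = (-1 : ℝ) ^ (i : ℕ) * T (Fin.cons j K) := by
  have h := hT (Fin.cons j K) i.cycleRange
  rw [Fin.cons_comp_cycleRange] at h
  rw [h, Fin.sign_cycleRange]
  simp

lemma contr_dT {n p : ℕ} (ξ : Tens n p) (x : Pt n) (T : (Fin (p+1) → Fin n) → ℝ) (hT : Alt1 T) :
    ∑ A, dT ξ x A * T A =
      (p + 1 : ℝ) * ∑ j, ∑ K : Fin p → Fin n, pd j (fun y => ξ y K) x * T (Fin.cons j K) := by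
  simp only [dT, Finset.sum_mul]
  rw [Finset.sum_comm]
  have : ∀ i : Fin (p+1), ∑ A : Fin (p+1) → Fin n,
      (-1 : ℝ) ^ (i : ℕ) * pd (A i) (fun y => ξ y (i.removeNth A)) x * T A
      = ∑ j, ∑ K : Fin p → Fin n, pd j (fun y => ξ y K) x * T (Fin.cons j K) := by
    intro i
    rw [sum_insertNth i]
    refine Finset.sum_congr rfl fun j _ => Finset.sum_congr rfl fun K _ => ?_
    rw [alt_insertNth T hT]
    simp only [Fin.insertNth_apply_same, Fin.removeNth_insertNth]
    have : (-1 : ℝ) ^ (i : ℕ) * (-1 : ℝ) ^ (i : ℕ) = 1 := by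
      rw [← mul_pow]; simp
    linear_combination (pd j (fun y => ξ y K) x * T (Fin.cons j K)) * this
  simp [this]

lemma alt_wedge {n k l : ℕ} (A : Tens n k) (B : Tens n l) (x : Pt n) : Alt1 (wedgeV A B x) := by
  intro a τ
  simp only [wedgeV]
  rw [mul_left_comm]
  congr 1
  rw [Finset.mul_sum]
  refine Fintype.sum_equiv (Equiv.mulLeft τ) _ _ fun σ => ?_
  simp only [Equiv.coe_mulLeft, Equiv.Perm.sign_mul, Function.comp, Equiv.Perm.mul_apply]
  push_cast
  have := sign_mul_self_real τ
  generalize A x _ = u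
  generalize B x _ = v
  linear_combination (-(((Equiv.Perm.sign σ : ℤ) : ℝ) * u * v)) * this

lemma alt_append {n k l : ℕ} (T : (Fin (k+l) → Fin n) → ℝ) (hT : Alt1 T) (b : Fin k → Fin n) :
    Alt1 (fun A : Fin l → Fin n => T (Fin.append b A)) := by
  intro A σ
  let τ : Equiv.Perm (Fin (k+l)) :=
    (finSumFinEquiv.symm.trans (Equiv.sumCongr 1 σ)).trans finSumFinEquiv
  have hs : Equiv.Perm.sign τ = Equiv.Perm.sign σ := by
    have h1 := Equiv.Perm.sign_symm_trans_trans (Equiv.Perm.sumCongr (1 : Equiv.Perm (Fin k)) σ)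
      (finSumFinEquiv (m := k) (n := l))
    rw [Equiv.Perm.sign_sumCongr, Equiv.Perm.sign_one, one_mul] at h1
    exact h1
  have h := hT (Fin.append b A) τ
  rw [hs] at h
  rw [← h]
  show T _ = T _
  congr 1
  funext i
  refine Fin.addCases (fun i => ?_) (fun i => ?_) i
  · simp [τ]
  · simp [τ]

lemma rhs_formula {n q : ℕ} (P : Tens n (q + 2)) (hPa : AltT P) (ξ : Tens n (q+1)) (x : Pt n)
    (a : Fin (q+2) → Fin n) :
    (-((fun x a => contrF (dT ξ) P x * P x a)
            - ((q + 2 : ℝ))⁻¹ • contrIn (dT ξ) (wedgeV P P)) : Tens n (q+2)) x a =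
    -(((q+1).factorial : ℝ)⁻¹ * ∑ j, ∑ K : Fin (q+1) → Fin n, pd j (fun y => ξ y K) x *
      (P x (Fin.cons j K) * P x a
        - (q + 2 : ℝ)⁻¹ * wedgeV P P x (Fin.append a (Fin.cons j K)))) := by
  have h1 := contr_dT ξ x (P x) (hPa x)
  have h2 := contr_dT ξ x (fun A => wedgeV P P x (Fin.append a A))
    (alt_append _ (alt_wedge P P x) a)
  simp only [Pi.neg_apply, Pi.sub_apply, Pi.smul_apply, contrF, contrIn, smul_eq_mul]
  rw [h1, h2]
  have hf : ((q+1+1).factorial : ℝ) = (q + 2 : ℝ) * ((q+1).factorial : ℝ) := by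
    rw [Nat.factorial_succ]; push_cast; ring
  have e : ∑ j, ∑ K : Fin (q+1) → Fin n, pd j (fun y => ξ y K) x *
      (P x (Fin.cons j K) * P x a
        - (q + 2 : ℝ)⁻¹ * wedgeV P P x (Fin.append a (Fin.cons j K)))
      = (∑ j, ∑ K : Fin (q+1) → Fin n, pd j (fun y => ξ y K) x * P x (Fin.cons j K)) * P x a
        - (q + 2 : ℝ)⁻¹ * ∑ j, ∑ K : Fin (q+1) → Fin n, pd j (fun y => ξ y K) x *
          wedgeV P P x (Fin.append a (Fin.cons j K)) := by
    simp only [Finset.sum_mul, Finset.mul_sum, ← Finset.sum_sub_distrib]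
    refine Finset.sum_congr rfl fun j _ => Finset.sum_congr rfl fun K _ => ?_
    ring
  rw [e, hf]
  have hq : (q + 2 : ℝ) ≠ 0 := by positivity
  have hq' : ((q+1).factorial : ℝ) ≠ 0 := by positivity
  push_cast
  field_simp
  ring

/-! ### The key identity -/

lemma wedge_zero {n k : ℕ} (P : Tens n (k+1)) (x : Pt n) (c : ℝ) (ε : Fin n → Fin (k+1) → ℝ)
    (hP : ∀ a, P x a = c * Matrix.det (fun i => ε (a i))) (b) : wedgeV P P x b = 0 := by
  let d := (Matrix.detRowAlternating (n := Fin (k+1)) (R := ℝ)).toMultilinearMap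
  let m : MultilinearMap ℝ (fun _ : Fin (k+1+(k+1)) => Fin (k+1) → ℝ) ℝ :=
    (((LinearMap.mul' ℝ ℝ).compMultilinearMap (d.domCoprod d)).domDomCongr finSumFinEquiv)
  have hm : ∀ v, m v = Matrix.det (fun i => v (Fin.castAdd _ i)) *
      Matrix.det (fun i => v (Fin.natAdd _ i)) := by
    intro v
    simp [m, d]
    rfl
  have h0 : MultilinearMap.alternatization m (fun i => ε (b i)) = 0 := by
    apply AlternatingMap.map_linearDependent
    intro h
    have := h.fintype_card_le_finrank
    simp at this
  rw [MultilinearMap.alternatization_apply] at h0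
  simp only [wedgeV, hP]
  refine mul_eq_zero_of_right _ ?_
  have h1 := congrArg (fun t => c * c * t) h0
  simp only [mul_zero, Finset.mul_sum] at h1
  rw [← h1]
  refine Finset.sum_congr rfl fun σ _ => ?_
  simp only [MultilinearMap.domDomCongr_apply, hm]
  rw [Units.smul_def, zsmul_eq_mul]
  ring

lemma key_identity_pos {n q : ℕ} (P : Tens n (q + 1 + 2)) (x : Pt n) (hPa : Alt1 (P x))
    (hA : ∀ (a : Fin (q+1+2) → Fin n) (β : Fin n → ℝ) (κ : Fin (q+1) → Fin n → ℝ),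
      ∑ r, toAlt (P x) hPa (Fin.cons (Pi.single (a r) 1) (Fin.cons β κ)) *
        toAlt (P x) hPa (Function.update (fun i => Pi.single (a i) 1) r β) = 0)
    (a : Fin (q+1+2) → Fin n) (j : Fin n) (K : Fin (q+1+1) → Fin n) :
    ∑ r, P x (Fin.cons (a r) K) * P x (Function.update a r j) =
      P x (Fin.cons j K) * P x a
        - (((q+1 : ℕ) : ℝ) + 2)⁻¹ * wedgeV P P x (Fin.append a (Fin.cons j K)) := by
  obtain ⟨c, E, hE⟩ := decomposable (toAlt (P x) hPa) (by
    intro α β κ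
    let g : (Fin n → ℝ) →ₗ[ℝ] (Fin n → ℝ) :=
      ((toAlt (P x) hPa).toMultilinearMap.toLinearMap (Fin.cons 0 (Fin.cons β κ)) 0).smulRight β
    have hg : ∀ v, g v = toAlt (P x) hPa (Fin.cons v (Fin.cons β κ)) • β := by
      intro v; simp [g]
    let M : MultilinearMap ℝ (fun _ : Fin (q+1+2) => Fin n → ℝ) ℝ :=
      ∑ r, (toAlt (P x) hPa).toMultilinearMap.compLinearMap
        (Function.update (fun _ => LinearMap.id) r g)
    have hM : ∀ v, M v = ∑ r, toAlt (P x) hPa (Fin.cons (v r) (Fin.cons β κ)) *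
        toAlt (P x) hPa (Function.update v r β) := by
      intro v
      simp only [M, _root_.sum_apply]
      refine Finset.sum_congr rfl fun r _ => ?_
      rw [MultilinearMap.compLinearMap_apply]
      have : (fun i => (Function.update (fun _ => LinearMap.id) r g :
          Fin (q+1+2) → ((Fin n → ℝ) →ₗ[ℝ] (Fin n → ℝ))) i (v i))
          = Function.update v r (toAlt (P x) hPa (Fin.cons (v r) (Fin.cons β κ)) • β) := by
        funext i
        by_cases hi : i = r
        · subst hi; simp [hg]
        · simp [Function.update_of_ne hi]
      rw [this]
      exact (toAlt (P x) hPa).map_update_smul _ _ _ _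
    rw [← hM]
    have : M = 0 := by
      refine Module.Basis.ext_multilinear (fun _ => Pi.basisFun ℝ (Fin n)) fun v => ?_
      rw [hM]
      simpa using hA v β κ
    rw [this]; rfl)
  have hP : ∀ b, P x b = c * Matrix.det (fun i => E (Pi.single (b i) 1)) := by
    intro b
    rw [← toAlt_single (P x) hPa b, hE]
  rw [wedge_zero P x c (fun i => E (Pi.single i 1)) hP]
  have h := plucker_det (fun i => E (Pi.single (a i) 1)) (E (Pi.single j 1))
    (fun i => E (Pi.single (K i) 1))
  have hc : ∀ s : Fin n, P x (Fin.cons s K) =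
      c * Matrix.det (Fin.cons (E (Pi.single s 1)) (fun i => E (Pi.single (K i) 1)) :
        Fin (q+1+1+1) → Fin (q+1+1+1) → ℝ) := by
    intro s
    rw [hP]
    congr 2
    funext i
    refine Fin.cases ?_ (fun i => ?_) i <;> simp
  have hu : ∀ r, P x (Function.update a r j) =
      c * (Matrix.updateRow (fun i => E (Pi.single (a i) 1)) r (E (Pi.single j 1))).det := by
    intro r
    rw [hP]
    congr 2
    funext i
    funext l
    refine Eq.trans ?_ Matrix.updateRow_apply.symm
    by_cases hi : i = r
    · subst hi; simp
    · simp [Function.update_of_ne hi, hi]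
  simp only [hc, hu]
  rw [hP a]
  have h1 := congrArg (fun t => c * c * t) h
  simp only [Finset.mul_sum] at h1
  refine Eq.trans (Finset.sum_congr rfl fun r _ => ?_) (h1.trans ?_)
  · ring
  · ring

lemma sum_perm4 (g : Equiv.Perm (Fin 4) → ℝ) :
    ∑ σ, g σ = ∑ p : Fin 4, ∑ r : Fin 3, ∑ s : Fin 2,
      g (Equiv.Perm.decomposeFin.symm (p, Equiv.Perm.decomposeFin.symm
        (r, Equiv.Perm.decomposeFin.symm (s, 1)))) := by
  rw [← Equiv.sum_comp Equiv.Perm.decomposeFin.symm, Fintype.sum_prod_type]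
  refine Finset.sum_congr rfl fun p _ => ?_
  rw [← Equiv.sum_comp Equiv.Perm.decomposeFin.symm, Fintype.sum_prod_type]
  refine Finset.sum_congr rfl fun r _ => ?_
  rw [← Equiv.sum_comp Equiv.Perm.decomposeFin.symm, Fintype.sum_prod_type]
  refine Finset.sum_congr rfl fun s _ => ?_
  rw [Fintype.sum_unique]
  rfl

lemma key_identity_zero {n : ℕ} (P : Tens n 2) (x : Pt n) (hPa : Alt1 (P x))
    (a : Fin 2 → Fin n) (j : Fin n) (K : Fin 1 → Fin n) :
    ∑ r, P x (Fin.cons (a r) K) * P x (Function.update a r j) =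
      P x (Fin.cons j K) * P x a
        - (((0 : ℕ) : ℝ) + 2)⁻¹ * wedgeV P P x (Fin.append a (Fin.cons j K)) := by
  let u : Fin n → Fin n → ℝ := fun r s => P x ![r, s]
  have hu : ∀ b : Fin 2 → Fin n, P x b = u (b 0) (b 1) := by
    intro b
    simp only [u]
    congr 1
    funext i
    fin_cases i <;> rfl
  have hanti : ∀ r s, u r s = - u s r := by
    intro r s
    have := hPa ![s, r] (Equiv.swap 0 1)
    rw [Equiv.Perm.sign_swap (by decide), hu, hu] at this
    simpa using this
  let v : Fin 4 → Fin n := ![a 0, a 1, j, K 0]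
  have hw : wedgeV P P x (Fin.append a (Fin.cons j K)) = (4:ℝ)⁻¹ *
      ∑ σ : Equiv.Perm (Fin 4), ((Equiv.Perm.sign σ : ℤ) : ℝ) * u (v (σ 0)) (v (σ 1)) *
        u (v (σ 2)) (v (σ 3)) := by
    have hv : (Fin.append a (Fin.cons j K : Fin 2 → Fin n)) = v := by
      funext i
      fin_cases i <;> rfl
    rw [hv]
    simp only [wedgeV, hu]
    norm_num [Nat.factorial]
    rfl
  rw [hw, sum_perm4]
  have e2 : (2 : Fin 4) = Fin.succ (Fin.succ 0) := rfl
  have e3 : (3 : Fin 4) = Fin.succ (Fin.succ (Fin.succ 0)) := rfl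
  have e1 : (1 : Fin 4) = Fin.succ 0 := rfl
  simp only [Equiv.Perm.decomposeFin.symm_sign, e1, e2, e3,
    Equiv.Perm.decomposeFin_symm_apply_zero, Equiv.Perm.decomposeFin_symm_apply_succ, hu]
  simp [Fin.sum_univ_succ, Equiv.swap_apply_def, v]
  generalize a 0 = A
  generalize a 1 = B
  generalize K 0 = C
  rw [hanti B A, hanti j A, hanti j B, hanti C A, hanti C B, hanti C j]
  ring

/-! ### Analysis -/

lemma pd_smooth {n : ℕ} (j : Fin n) (f : Pt n → ℝ) (hf : ContDiff ℝ (⊤ : ℕ∞) f) :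
    ContDiff ℝ (⊤ : ℕ∞) (pd j f) := by
  unfold pd
  exact (hf.fderiv_right (m := (⊤ : ℕ∞)) (by norm_cast)).clm_apply contDiff_const

lemma pd_comm {n : ℕ} (i j : Fin n) (f : Pt n → ℝ) (hf : ContDiff ℝ (⊤ : ℕ∞) f) (x : Pt n) :
    pd i (pd j f) x = pd j (pd i f) x := by
  have hd : DifferentiableAt ℝ (fderiv ℝ f) x :=
    ((hf.fderiv_right (m := (⊤ : ℕ∞)) (by norm_cast)).differentiable (by simp)) x
  have e : ∀ i j : Fin n, pd i (pd j f) x =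
      fderiv ℝ (fderiv ℝ f) x (Pi.single i 1) (Pi.single j 1) := by
    intro i j
    unfold pd
    rw [fderiv_clm_apply hd (differentiableAt_const _)]
    simp
  rw [e, e]
  have := (hf.contDiffAt (x := x)).isSymmSndFDerivAt (by simp [minSmoothness_of_isRCLikeNormedField]; norm_cast)
  exact this _ _

lemma smooth_diff {n : ℕ} {f : Pt n → ℝ} (hf : ContDiff ℝ (⊤ : ℕ∞) f) (x : Pt n) :
    DifferentiableAt ℝ f x := hf.differentiable (by simp) x

lemma pd_mul {n : ℕ} (j : Fin n) {f g : Pt n → ℝ} {x : Pt n} (hf : DifferentiableAt ℝ f x)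
    (hg : DifferentiableAt ℝ g x) :
    pd j (fun y => f y * g y) x = pd j f x * g x + f x * pd j g x := by
  unfold pd
  rw [fderiv_fun_mul hf hg]
  simp; ring

lemma pd_sum {n : ℕ} {ι : Type*} (s : Finset ι) (j : Fin n) {f : ι → Pt n → ℝ} {x : Pt n}
    (hf : ∀ i ∈ s, DifferentiableAt ℝ (f i) x) :
    pd j (fun y => ∑ i ∈ s, f i y) x = ∑ i ∈ s, pd j (f i) x := by
  unfold pd
  rw [fderiv_fun_sum hf]
  simp

lemma pd_const_mul {n : ℕ} (j : Fin n) {f : Pt n → ℝ} {x : Pt n} (c : ℝ)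
    (hf : DifferentiableAt ℝ f x) :
    pd j (fun y => c * f y) x = c * pd j f x := by
  unfold pd
  rw [fderiv_const_mul hf]
  simp

lemma pd_mul_const {n : ℕ} (j : Fin n) {f : Pt n → ℝ} {x : Pt n} (c : ℝ)
    (hf : DifferentiableAt ℝ f x) :
    pd j (fun y => f y * c) x = pd j f x * c := by
  unfold pd
  rw [fderiv_mul_const hf]
  simp; ring

lemma pd_coord {n : ℕ} (j i : Fin n) (x : Pt n) :
    pd j (fun y => y i) x = (Pi.single i (1:ℝ) : Fin n → ℝ) j := by
  unfold pd
  rw [(hasFDerivAt_apply i x).fderiv]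
  simp [Pi.single_apply, eq_comm]

lemma dfWedge_smooth {n p : ℕ} (f : Fin p → (Pt n → ℝ)) (hf : ∀ i, ContDiff ℝ (⊤ : ℕ∞) (f i)) :
    SmoothT (dfWedge f) := by
  intro a
  unfold dfWedge
  refine ContDiff.sum fun σ _ => contDiff_const.mul (contDiff_prod fun i _ => pd_smooth _ _ (hf i))

lemma dfWedge_alt {n p : ℕ} (f : Fin p → (Pt n → ℝ)) : AltT (dfWedge f) := by
  intro x a τ
  simp only [dfWedge]
  rw [Finset.mul_sum]
  refine Fintype.sum_equiv (Equiv.mulLeft τ) _ _ fun σ => ?_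
  simp only [Equiv.coe_mulLeft, Equiv.Perm.sign_mul, Function.comp, Equiv.Perm.mul_apply]
  push_cast
  have := sign_mul_self_real τ
  generalize (∏ i, pd (a (τ (σ i))) (f i) x) = u
  linear_combination (-(((Equiv.Perm.sign σ : ℤ) : ℝ) * u)) * this

lemma alt_cons {n p : ℕ} (T : (Fin (p+1) → Fin n) → ℝ) (hT : Alt1 T) (i : Fin n) :
    Alt1 (fun K : Fin p → Fin n => T (Fin.cons i K)) := by
  intro K σ
  have h := hT (Fin.cons i K) (Equiv.Perm.decomposeFin.symm (0, σ))
  rw [Equiv.Perm.decomposeFin.symm_sign, if_pos rfl, one_mul] at h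
  rw [← h]
  show T _ = T _
  congr 1
  funext l
  refine Fin.cases ?_ (fun l => ?_) l
  · simp
  · simp [Equiv.Perm.decomposeFin_symm_apply_succ]

lemma dfWedge_contract {n p : ℕ} (f : Fin p → (Pt n → ℝ)) (y : Pt n) (T : (Fin p → Fin n) → ℝ)
    (hT : Alt1 T) :
    ∑ K, dfWedge f y K * T K = (p.factorial : ℝ) * ∑ K : Fin p → Fin n,
      (∏ m, pd (K m) (f m) y) * T K := by
  simp only [dfWedge, Finset.sum_mul]
  rw [Finset.sum_comm]
  have : ∀ σ : Equiv.Perm (Fin p), ∑ K : Fin p → Fin n,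
      ((Equiv.Perm.sign σ : ℤ) : ℝ) * (∏ i, pd (K (σ i)) (f i) y) * T K
      = ∑ K : Fin p → Fin n, (∏ m, pd (K m) (f m) y) * T K := by
    intro σ
    refine Fintype.sum_equiv (Equiv.arrowCongr σ.symm (Equiv.refl _)) _ _ fun K => ?_
    have h : (Equiv.arrowCongr σ.symm (Equiv.refl (Fin n))) K = K ∘ σ := by
      ext; simp [Equiv.arrowCongr]
    rw [h, hT]
    simp only [Function.comp]
    ring
  simp [this, Fintype.card_perm]

lemma sharp_df {n p : ℕ} (P : Tens n (p+1)) (hPa : AltT P) (f : Fin p → (Pt n → ℝ)) :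
    sharp P (dfWedge f) = fun y i => ∑ K : Fin p → Fin n,
      (∏ m, pd (K m) (f m) y) * P y (Fin.cons i K) := by
  funext y i
  simp only [sharp]
  rw [dfWedge_contract f y _ (alt_cons (P y) (hPa y) i)]
  have : (p.factorial : ℝ) ≠ 0 := by positivity
  field_simp

lemma sum_swap_zero {n k : ℕ} (T H : (Fin k → Fin n) → ℝ) (hT : Alt1 T) (i j : Fin k) (hij : i ≠ j)
    (hH : ∀ A, H (A ∘ Equiv.swap i j) = H A) : ∑ A, H A * T A = 0 := by
  have h : ∑ A, H A * T A = ∑ A, -(H A * T A) := by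
    refine Fintype.sum_equiv (Equiv.arrowCongr (Equiv.swap i j) (Equiv.refl _)) _ _ fun A => ?_
    have h : (Equiv.arrowCongr (Equiv.swap i j) (Equiv.refl (Fin n))) A = A ∘ Equiv.swap i j := by
      ext; simp [Equiv.arrowCongr]
    rw [h, hH, hT, Equiv.Perm.sign_swap hij]
    simp
  rw [Finset.sum_neg_distrib] at h
  linarith

lemma closed_contract {n p : ℕ} (f : Fin p → (Pt n → ℝ)) (hf : ∀ i, ContDiff ℝ (⊤ : ℕ∞) (f i))
    (x : Pt n) (T : (Fin (p+1) → Fin n) → ℝ) (hT : Alt1 T) :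
    ∑ j, ∑ K : Fin p → Fin n, pd j (fun y => dfWedge f y K) x * T (Fin.cons j K) = 0 := by
  have hw := dfWedge_smooth f hf
  have hpd : ∀ (l : Fin n) m, DifferentiableAt ℝ (pd l (f m)) x :=
    fun l m => smooth_diff (pd_smooth l _ (hf m)) x
  have hprod : ∀ K : Fin p → Fin n, DifferentiableAt ℝ (fun y => ∏ m, pd (K m) (f m) y) x :=
    fun K => smooth_diff (contDiff_prod fun i _ => pd_smooth _ _ (hf i)) x
  have h1 : ∀ j, ∑ K : Fin p → Fin n, pd j (fun y => dfWedge f y K) x * T (Fin.cons j K)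
      = (p.factorial : ℝ) * ∑ l : Fin p, ∑ K : Fin p → Fin n,
        ((∏ m ∈ Finset.univ.erase l, pd (K m) (f m) x) * pd j (pd (K l) (f l)) x)
          * T (Fin.cons j K) := by
    intro j
    have e1 : ∑ K : Fin p → Fin n, pd j (fun y => dfWedge f y K) x * T (Fin.cons j K)
        = pd j (fun y => ∑ K : Fin p → Fin n, dfWedge f y K * T (Fin.cons j K)) x := by
      rw [pd_sum _ _ (fun K _ => (smooth_diff (hw K) x).mul_const _)]
      exact Finset.sum_congr rfl fun K _ => (pd_mul_const _ _ (smooth_diff (hw K) x)).symm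
    rw [e1]
    simp only [fun y => dfWedge_contract f y _ (alt_cons T hT j)]
    rw [pd_const_mul _ _ (DifferentiableAt.fun_sum fun K _ => (hprod K).mul_const _),
      pd_sum _ _ (fun K _ => (hprod K).mul_const _), Finset.sum_comm]
    congr 1
    refine Finset.sum_congr rfl fun K _ => ?_
    rw [pd_mul_const _ _ (hprod K), ← Finset.sum_mul]
    congr 1
    conv_lhs => unfold pd
    have := fderiv_finsetProd (𝕜 := ℝ) (u := (Finset.univ : Finset (Fin p)))
      (g := fun m => pd (K m) (f m)) (x := x) (fun i _ => hpd _ _)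
    have e2 : (fun y => ∏ m, fderiv ℝ (f m) y (Pi.single (K m) 1)) =
      fun y => ∏ m, pd (K m) (f m) y := by
      funext y; simp [pd]
    rw [e2, this]
    simp [pd]
  simp only [h1]
  rw [← Finset.mul_sum, Finset.sum_comm]
  refine mul_eq_zero_of_right _ (Finset.sum_eq_zero fun l _ => ?_)
  have h2 := sum_swap_zero T (fun A => (∏ m ∈ Finset.univ.erase l, pd (A m.succ) (f m) x) *
    pd (A 0) (pd (A l.succ) (f l)) x) hT 0 l.succ (Fin.succ_ne_zero l).symm (by
      intro A
      simp only [Function.comp, Equiv.swap_apply_left, Equiv.swap_apply_right]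
      rw [pd_comm _ _ _ (hf l)]
      congr 1
      refine Finset.prod_congr rfl fun m hm => ?_
      rw [Equiv.swap_apply_of_ne_of_ne (Fin.succ_ne_zero m)
        (fun h => (Finset.ne_of_mem_erase hm) (Fin.succ_injective _ h))])
  rw [sum_cons] at h2
  simpa using h2

lemma lie_formula {n p : ℕ} (P : Tens n (p+1)) (hPs : SmoothT P) (ξ : Tens n p) (hξ : SmoothT ξ)
    (hD : ∀ (κ : Fin p → Fin n) (x : Pt n) (a : Fin (p+1) → Fin n),
      lieDV (fun y i => P y (Fin.cons i κ)) P x a = 0) (x : Pt n) (a : Fin (p+1) → Fin n) :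
    lieDV (sharp P ξ) P x a = -((p.factorial : ℝ)⁻¹ * ∑ j, ∑ K : Fin p → Fin n,
      pd j (fun y => ξ y K) x * ∑ r, P x (Fin.cons (a r) K) * P x (Function.update a r j)) := by
  have hV : sharp P ξ x = (p.factorial : ℝ)⁻¹ • ∑ K : Fin p → Fin n,
      ξ x K • (fun i => P x (Fin.cons i K)) := by
    funext i
    simp [sharp, Finset.sum_apply]
  have hpd : ∀ j i, pd j (fun y => sharp P ξ y i) x = (p.factorial : ℝ)⁻¹ *
      ∑ K : Fin p → Fin n, (pd j (fun y => ξ y K) x * P x (Fin.cons i K)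
        + ξ x K * pd j (fun y => P y (Fin.cons i K)) x) := by
    intro j i
    have hdd : ∀ K : Fin p → Fin n, DifferentiableAt ℝ (fun y => ξ y K * P y (Fin.cons i K)) x :=
      fun K => (smooth_diff (hξ K) x).mul (smooth_diff (hPs _) x)
    simp only [sharp]
    rw [pd_const_mul _ _ (DifferentiableAt.fun_sum fun K _ => hdd K), pd_sum _ _ (fun K _ => hdd K)]
    congr 1
    exact Finset.sum_congr rfl fun K _ => pd_mul _ (smooth_diff (hξ K) x) (smooth_diff (hPs _) x)
  have hD' : ∑ K : Fin p → Fin n, ξ x K * lieDV (fun y i => P y (Fin.cons i K)) P x a = 0 :=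
    Finset.sum_eq_zero fun K _ => by rw [hD, mul_zero]
  simp only [lieDV] at hD' ⊢
  rw [hV]
  simp only [hpd, map_smul, map_sum, smul_eq_mul]
  have hf0 : (p.factorial : ℝ) ≠ 0 := by positivity
  have e : ∑ r, ∑ j, (p.factorial : ℝ)⁻¹ *
      (∑ K : Fin p → Fin n, (pd j (fun y => ξ y K) x * P x (Fin.cons (a r) K)
        + ξ x K * pd j (fun y => P y (Fin.cons (a r) K)) x)) * P x (Function.update a r j)
      = (p.factorial : ℝ)⁻¹ * (∑ j, ∑ K : Fin p → Fin n,
      pd j (fun y => ξ y K) x * ∑ r, P x (Fin.cons (a r) K) * P x (Function.update a r j))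
      + (p.factorial : ℝ)⁻¹ * ∑ K : Fin p → Fin n, ξ x K * ∑ r, ∑ j,
        pd j (fun y => P y (Fin.cons (a r) K)) x * P x (Function.update a r j) := by
    rw [← mul_add]
    simp only [mul_assoc, ← Finset.mul_sum]
    congr 1
    simp only [Finset.sum_mul, add_mul, Finset.sum_add_distrib, Finset.mul_sum]
    congr 1
    · rw [Finset.sum_comm]
      refine Finset.sum_congr rfl fun j _ => ?_
      rw [Finset.sum_comm]
      exact Finset.sum_congr rfl fun K _ => Finset.sum_congr rfl fun r _ => by ring
    · have : ∀ r : Fin (p+1), ∑ j, ∑ K : Fin p → Fin n,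
        ξ x K * pd j (fun y => P y (Fin.cons (a r) K)) x * P x (Function.update a r j)
        = ∑ K : Fin p → Fin n, ∑ j,
        ξ x K * (pd j (fun y => P y (Fin.cons (a r) K)) x * P x (Function.update a r j)) := by
        intro r
        rw [Finset.sum_comm]
        exact Finset.sum_congr rfl fun K _ => Finset.sum_congr rfl fun r _ => by ring
      simp only [this]
      rw [Finset.sum_comm]
  rw [e]
  simp only [mul_sub, Finset.sum_sub_distrib] at hD'
  linear_combination (p.factorial : ℝ)⁻¹ * hD'

lemma np_linear {n p : ℕ} (P : Tens n (p+1)) (hPa : AltT P) (h : NambuPoisson P)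
    (κ : Fin p → Fin n) (x : Pt n) (a : Fin (p+1) → Fin n) :
    lieDV (fun y i => P y (Fin.cons i κ)) P x a = 0 := by
  have h1 := h (fun m y => y (κ m)) (fun m => contDiff_apply ℝ ℝ (κ m))
  rw [sharp_df P hPa] at h1
  simp only [pd_coord, fun y i => sum_prod_single (fun K => P y (Fin.cons i K)) κ] at h1
  rw [h1]; rfl

lemma np_quad {n q : ℕ} (P : Tens n (q+2)) (hPs : SmoothT P) (hPa : AltT P) (h : NambuPoisson P)
    (x : Pt n) (hPx : Alt1 (P x)) (a : Fin (q+2) → Fin n) (β : Fin n → ℝ) (κ : Fin q → Fin n → ℝ) :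
    ∑ r, toAlt (P x) hPx (Fin.cons (Pi.single (a r) 1) (Fin.cons β κ)) *
        toAlt (P x) hPx (Function.update (fun i => Pi.single (a i) 1) r β) = 0 := by
  let ℓ : Pt n → ℝ := fun y => ∑ j, β j * (y j - x j)
  have hℓ : ContDiff ℝ (⊤ : ℕ∞) ℓ :=
    ContDiff.sum fun j _ => contDiff_const.mul ((contDiff_apply ℝ ℝ j).sub contDiff_const)
  have hlin : ∀ (c : Fin n → ℝ) (b : Pt n) (l : Fin n) (y : Pt n),
      pd l (fun y => ∑ j, c j * (y j - b j)) y = c l := by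
    intro c b l y
    have hd : ∀ j : Fin n, DifferentiableAt ℝ (fun y : Pt n => y j - b j) y :=
      fun j => (differentiableAt_apply (𝕜 := ℝ) j y).sub_const _
    rw [pd_sum _ _ (fun j _ => (hd j).const_mul _)]
    have : ∀ j, pd l (fun y : Pt n => c j * (y j - b j)) y
        = c j * (Pi.single j (1:ℝ) : Fin n → ℝ) l := by
      intro j
      rw [pd_const_mul _ _ (hd j), ← pd_coord l j y]
      unfold pd
      rw [fderiv_sub_const]
    simp [this, Pi.single_apply]
  have hℓx : ℓ x = 0 := by simp [ℓ]
  let f : Fin (q+1) → Pt n → ℝ :=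
    Fin.cons (fun y => 2⁻¹ * (ℓ y * ℓ y)) (fun m y => ∑ j, κ m j * (y j - x j))
  have hf : ∀ m, ContDiff ℝ (⊤ : ℕ∞) (f m) := by
    intro m
    refine Fin.cases ?_ (fun m => ?_) m
    · exact contDiff_const.mul (hℓ.mul hℓ)
    · show ContDiff ℝ (⊤ : ℕ∞) (fun y : Pt n => ∑ j, κ m j * (y j - x j))
      exact ContDiff.sum fun j _ => contDiff_const.mul
        ((contDiff_apply ℝ ℝ j).sub contDiff_const)
  have hpf : ∀ (K : Fin (q+1) → Fin n) y, ∏ m, pd (K m) (f m) y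
      = ℓ y * ∏ m, (Fin.cons β κ : Fin (q+1) → Fin n → ℝ) m (K m) := by
    intro K y
    rw [Fin.prod_univ_succ, Fin.prod_univ_succ]
    simp only [f, Fin.cons_zero, Fin.cons_succ, hlin]
    rw [pd_const_mul _ _ ((smooth_diff hℓ y).fun_mul (smooth_diff hℓ y)),
      pd_mul _ (smooth_diff hℓ y) (smooth_diff hℓ y)]
    have : pd (K 0) ℓ y = β (K 0) := hlin _ _ _ _
    rw [this]; ring
  have h1 := h f hf
  rw [sharp_df P hPa] at h1
  let Q : Fin n → Pt n → ℝ := fun i y => ∑ K : Fin (q+1) → Fin n,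
    (∏ m, (Fin.cons β κ : Fin (q+1) → Fin n → ℝ) m (K m)) * P y (Fin.cons i K)
  have hQ : ∀ i, ContDiff ℝ (⊤ : ℕ∞) (Q i) := fun i =>
    ContDiff.sum fun K _ => contDiff_const.mul (hPs _)
  have hVQ : (fun y i => ∑ K : Fin (q+1) → Fin n,
      (∏ m, pd (K m) (f m) y) * P y (Fin.cons i K)) = fun y i => ℓ y * Q i y := by
    funext y i
    simp only [hpf, Q, Finset.mul_sum, mul_assoc]
  rw [hVQ] at h1
  have h2 := congrFun (congrFun h1 x) a
  have hpd : ∀ j i, pd j (fun y => ℓ y * Q i y) x = β j * Q i x := by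
    intro j i
    rw [pd_mul _ (smooth_diff hℓ x) (smooth_diff (hQ i) x), hℓx]
    have : pd j ℓ x = β j := hlin _ _ _ _
    rw [this]; ring
  have h0 : (fun i => ℓ x * Q i x) = 0 := by funext i; simp [hℓx]
  simp only [lieDV, hpd, h0, map_zero, zero_sub, Pi.zero_apply, neg_eq_zero] at h2
  rw [← h2]
  refine Finset.sum_congr rfl fun r _ => ?_
  have hQx : toAlt (P x) hPx (Fin.cons (Pi.single (a r) 1) (Fin.cons β κ)) = Q (a r) x := by
    rw [toAlt_apply, sum_cons]
    simp only [Fin.prod_univ_succ (n := q+1), Fin.cons_zero, Fin.cons_succ, Q]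
    rw [Finset.sum_eq_single (a r)]
    · simp
    · intro j _ hj
      simp [hj]
    · simp
  have hβ : toAlt (P x) hPx (Function.update (fun i => Pi.single (a i) 1) r β)
      = ∑ j, β j * P x (Function.update a r j) := by
    have hb : β = ∑ j, β j • (Pi.single j (1:ℝ) : Fin n → ℝ) := by
      funext l; simp [Finset.sum_apply, Pi.single_apply]
    conv_lhs => rw [hb]
    rw [AlternatingMap.map_update_sum]
    refine Finset.sum_congr rfl fun j _ => ?_
    rw [AlternatingMap.map_update_smul, smul_eq_mul, ← toAlt_single (P x) hPx]
    congr 2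
    funext i
    by_cases hi : i = r
    · subst hi; simp
    · simp [Function.update_of_ne hi]
  rw [hQx, hβ, Finset.mul_sum]
  exact Finset.sum_congr rfl fun j _ => by ring

/-- A `(p+1)`-vector field `Π` satisfies the fundamental
identity (is a Nambu–Poisson structure) iff for every `p`-form `ξ` one has
`L_{Π^#(ξ)}(Π) = −( i_{dξ}(Π)·Π − (1/(p+1))·i_{dξ}(Π ∧ Π) )`
(here `p = q + 1`, so `1/(p+1) = 1/(q+2)`). -/
theorem nambu_poisson_iff_lie_derivative_formula {n q : ℕ}
    (P : Tens n (q + 2)) (hPs : SmoothT P) (hPa : AltT P) :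
    NambuPoisson P ↔
      ∀ ξ : Tens n (q + 1), SmoothT ξ → AltT ξ →
        lieDV (sharp P ξ) P =
          -((fun x a => contrF (dT ξ) P x * P x a)
            - ((q + 2 : ℝ))⁻¹ • contrIn (dT ξ) (wedgeV P P)) := by
  constructor
  · intro h ξ hξ _
    funext x a
    rw [rhs_formula P hPa ξ x a, lie_formula P hPs ξ hξ (np_linear P hPa h)]
    congr 2
    refine Finset.sum_congr rfl fun j _ => Finset.sum_congr rfl fun K _ => ?_
    congr 1
    cases q with
    | zero => exact key_identity_zero P x (hPa x) a j K
    | succ q => exact key_identity_pos P x (hPa x) (np_quad P hPs hPa h x (hPa x)) a j K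
  · intro h f hf
    rw [h _ (dfWedge_smooth f hf) (dfWedge_alt f)]
    funext x a
    rw [rhs_formula P hPa _ x a, closed_contract f hf x (fun A => P x A * P x a
        - (q + 2 : ℝ)⁻¹ * wedgeV P P x (Fin.append a A)) ?_]
    · simp
    · intro A σ
      have h1 := hPa x A σ
      have h2 := alt_append _ (alt_wedge P P x) a A σ
      simp only at h2 ⊢
      rw [h1, h2]
      ring
end
end

section
/- For p > 1, twisted Nambu–Poisson structures are redundant: if H is a closed (p+2)-form on M and Π is a smooth (p+1)-vector field satisfying the H-twisted condition (L_{Π^#(ξ)}(Π))^#(η) = −Π^#( i_{Π^#(η)}( dξ − i_{Π^#(ξ)}H ) ) for all ξ, η ∈ Ωᵖ(M), then Π also satisfies the untwisted condition (L_{Π^#(ξ)}(Π))^#(η) = −Π^#( i_{Π^#(η)}(dξ) ) for all ξ, η ∈ Ωᵖ(M); that is, Π is an ordinary Nambu–Poisson structure. -/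
/-!
We formalize the differential geometry over the model space `ℝⁿ` with its global
coordinates.  A differential `p`-form is represented by its fully antisymmetric,
smooth component array `Tens n p`, a `p`-vector field likewise by its
(contravariant) component array, and a vector field by its components.
Throughout, writing `p = q + 1` encodes the hypothesis `p ≥ 1`.
-/

open scoped BigOperators

noncomputable section

section NPAux
open Matrix

section AlgPart
variable {D : Type*} [AddCommGroup D] [Module ℝ D]

lemma np_alt_mem {m : ℕ} (A : D [⋀^Fin (m+1)]→ₗ[ℝ] ℝ) (x : D) (v : Fin m → D) (r : Fin m)
    (h : v r = x) : A (vecCons x v) = 0 :=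
  A.map_eq_zero_of_eq _ (i := 0) (j := r.succ) (by simp [h]) (Fin.succ_ne_zero r).symm

lemma np_alt_swap {m : ℕ} (A : D [⋀^Fin (m+2)]→ₗ[ℝ] ℝ) (x y : D) (v : Fin m → D) :
    A (vecCons x (vecCons y v)) = - A (vecCons y (vecCons x v)) := by
  have h := A.map_swap (vecCons y (vecCons x v)) (i := 0) (j := 1) (by simp)
  rw [← h]
  congr 1
  ext i
  refine Fin.cases ?_ (fun i => Fin.cases ?_ (fun i => ?_) i) i
  · simp
  · simp
  · have : Equiv.swap (0 : Fin (m+2)) 1 i.succ.succ = i.succ.succ :=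
      Equiv.swap_apply_of_ne_of_ne (Fin.succ_ne_zero _)
        (by rw [← Fin.succ_zero_eq_one]; exact fun h => Fin.succ_ne_zero _ (Fin.succ_injective _ h))
    simp [this]

lemma np_alt_swap' {m : ℕ} (A : D [⋀^Fin (m+3)]→ₗ[ℝ] ℝ) (z x y : D) (v : Fin m → D) :
    A (vecCons z (vecCons x (vecCons y v))) = - A (vecCons z (vecCons y (vecCons x v))) :=
  np_alt_swap (A.curryLeft z) x y v

/-- evaluation in the first slot -/
def npEv {m : ℕ} (A : D [⋀^Fin (m+1)]→ₗ[ℝ] ℝ) (v : Fin m → D) : D →ₗ[ℝ] ℝ where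
  toFun x := A.curryLeft x v
  map_add' x y := by simp
  map_smul' x y := by simp

/-- derivation-like contraction -/
def npC {m : ℕ} (A : D [⋀^Fin m]→ₗ[ℝ] ℝ) (φ : D →ₗ[ℝ] ℝ) (δ : D) : D [⋀^Fin m]→ₗ[ℝ] ℝ where
  toFun κ := ∑ r, φ (κ r) * A (Function.update κ r δ)
  map_update_add' := by
    intro inst κ i x y
    obtain rfl : inst = instDecidableEqFin m := Subsingleton.elim _ _
    rw [← Finset.sum_add_distrib]
    refine Finset.sum_congr rfl fun r _ => ?_
    by_cases h : r = i
    · subst h; simp; ring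
    · have h1 : ∀ z : D, Function.update κ i z r = κ r := fun z => Function.update_of_ne h _ _
      have h2 : ∀ z : D, Function.update (Function.update κ i z) r δ =
        Function.update (Function.update κ r δ) i z := fun z => Function.update_comm (Ne.symm h) _ _ _
      rw [h1, h1, h1, h2, h2, h2, AlternatingMap.map_update_add]; ring
  map_update_smul' := by
    intro inst κ i c x
    obtain rfl : inst = instDecidableEqFin m := Subsingleton.elim _ _
    rw [smul_eq_mul, Finset.mul_sum]
    refine Finset.sum_congr rfl fun r _ => ?_
    by_cases h : r = i
    · subst h; simp; ring
    · have h1 : ∀ z : D, Function.update κ i z r = κ r := fun z => Function.update_of_ne h _ _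
      have h2 : ∀ z : D, Function.update (Function.update κ i z) r δ =
        Function.update (Function.update κ r δ) i z := fun z => Function.update_comm (Ne.symm h) _ _ _
      rw [h1, h1, h2, h2, AlternatingMap.map_update_smul, smul_eq_mul]; ring
  map_eq_zero_of_eq' := by
    intro v i j hv hij
    change ∑ r, φ (v r) * A (Function.update v r δ) = 0
    rw [← Finset.sum_subset (Finset.subset_univ {i, j}), Finset.sum_pair hij]
    · have h : Function.update v j δ = Function.update v i δ ∘ Equiv.swap i j := by
        ext r
        by_cases h1 : r = i
        · subst h1; simp [Function.update_of_ne hij, Function.update_of_ne hij.symm, hv]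
        by_cases h2 : r = j
        · subst h2; simp
        simp [Equiv.swap_apply_of_ne_of_ne h1 h2, h1, h2]
      rw [h, A.map_swap _ hij, hv]; ring
    · intro r _ hr
      simp only [Finset.mem_insert, Finset.mem_singleton, not_or] at hr
      rw [A.map_eq_zero_of_eq (Function.update v r δ) (i := i) (j := j) _ hij]
      · simp
      · rw [Function.update_of_ne (Ne.symm hr.1), Function.update_of_ne (Ne.symm hr.2), hv]

lemma npC_apply {m : ℕ} (A : D [⋀^Fin m]→ₗ[ℝ] ℝ) (φ : D →ₗ[ℝ] ℝ) (δ : D) (κ : Fin m → D) :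
    npC A φ δ κ = ∑ r, φ (κ r) * A (Function.update κ r δ) := rfl

/-- the quadratic identity -/
def NPQuad {q : ℕ} (A : D [⋀^Fin (q+3)]→ₗ[ℝ] ℝ) : Prop :=
  ∀ (α β : Fin (q+2) → D) (γ δ : D),
    ∑ r, A (vecCons (β r) α) * A (vecCons γ (Function.update β r δ))
    + ∑ s : Fin (q+2), (-1:ℝ)^(s:ℕ) *
      (A (vecCons (α s) β) * A (vecCons γ (vecCons δ (s.removeNth α)))) = 0

/-- covectors invisible against the frame `e` -/
def NPF {q : ℕ} (A : D [⋀^Fin (q+3)]→ₗ[ℝ] ℝ) (e : Fin (q+3) → D) (f : D) : Prop :=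
  ∀ k : Fin (q+2) → Fin (q+3), A (vecCons f (e ∘ k)) = 0

lemma np_perm_ne {q : ℕ} (A : D [⋀^Fin (q+3)]→ₗ[ℝ] ℝ) (e : Fin (q+3) → D) (he : A e ≠ 0)
    (k : Fin (q+3) → Fin (q+3)) (hk : Function.Injective k) : A (e ∘ k) ≠ 0 := by
  let σ := Equiv.ofBijective k (Finite.injective_iff_bijective.1 hk)
  have h := A.map_perm e σ
  have h2 : (e ∘ ⇑σ) = e ∘ k := rfl
  rw [h2] at h
  rw [h]
  rcases Int.units_eq_one_or (Equiv.Perm.sign σ) with h | h <;> simp [h, he]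

lemma np_compl {m l : ℕ} (k : Fin m → Fin l) (h : m < l) : ∃ i, ∀ r, k r ≠ i := by
  by_contra hc
  push Not at hc
  have : Function.Surjective k := fun i => hc i
  have := Fintype.card_le_of_surjective k this
  simp at this
  omega

lemma np_cons_inj {m l : ℕ} (k : Fin m → Fin l) (hk : Function.Injective k) (i : Fin l)
    (hi : ∀ r, k r ≠ i) : Function.Injective (vecCons i k) := by
  intro a b
  refine Fin.cases ?_ (fun a => ?_) a <;> refine Fin.cases ?_ (fun b => ?_) b
  · simp
  · intro h; exact absurd (by simpa using h.symm) (hi b)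
  · intro h; exact absurd (by simpa using h) (hi a)
  · intro h; simp at h; rw [hk h]

lemma np_comp_cons {E : Type*} {m l : ℕ} (e : Fin l → E) (i : Fin l) (k : Fin m → Fin l) :
    e ∘ vecCons i k = vecCons (e i) (e ∘ k) := by
  ext a; refine Fin.cases ?_ (fun a => ?_) a <;> simp

lemma np_Q {q : ℕ} (A : D [⋀^Fin (q+3)]→ₗ[ℝ] ℝ) (hA : NPQuad A) (e : Fin (q+3) → D)
    (f f' : D) (hf : NPF A e f) (e0 e1 e2 : Fin (q+3)) (c : Fin q → Fin (q+3))
    (hne : A (vecCons (e e2) (vecCons (e e0) (vecCons (e e1) (e ∘ c)))) ≠ 0) :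
    A (vecCons (e e2) (vecCons f' (vecCons f (e ∘ c)))) = 0 := by
  have h := hA (vecCons (e e2) (vecCons f (e ∘ c))) (vecCons (e e0) (vecCons (e e1) (e ∘ c)))
    (e e2) f'
  have hz : ∀ x : Fin (q+3), A (vecCons (e x) (vecCons (e e2) (vecCons f (e ∘ c)))) = 0 := by
    intro x
    have := hf (vecCons x (vecCons e2 c))
    rw [np_comp_cons, np_comp_cons] at this
    rw [np_alt_swap', np_alt_swap, this]; simp
  rw [Fin.sum_univ_succ, Fin.sum_univ_succ, Fin.sum_univ_succ (n := q+1),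
    Fin.sum_univ_succ (n := q)] at h
  have h3 : ∀ x : Fin q, A (vecCons (e (c x)) (vecCons (e e0) (vecCons (e e1) (e ∘ c)))) = 0 :=
    fun x => np_alt_mem A _ _ x.succ.succ (by simp)
  have h4 : A (vecCons (e e2) (vecCons f' (vecCons (e e2) (e ∘ c)))) = 0 :=
    np_alt_mem A _ _ 1 (by simp)
  have h5 : (Fin.removeNth (0 : Fin (q+2)) (vecCons (e e2) (vecCons f (e ∘ c)))) =
      vecCons f (e ∘ c) := rfl
  have h6 : (Fin.removeNth (Fin.succ 0 : Fin (q+2)) (vecCons (e e2) (vecCons f (e ∘ c)))) =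
      vecCons (e e2) (e ∘ c) := by
    ext i; refine Fin.cases ?_ (fun i => ?_) i <;> simp [Fin.removeNth]
  rw [h5, h6] at h
  simp only [cons_val_zero, cons_val_succ, Function.comp_apply, hz, h3, h4] at h
  simp at h
  exact h.resolve_left hne

lemma np_Q1 {q : ℕ} (A : D [⋀^Fin (q+3)]→ₗ[ℝ] ℝ) (hA : NPQuad A) (e : Fin (q+3) → D)
    (he : A e ≠ 0) (f f' : D) (hf : NPF A e f) (k : Fin (q+1) → Fin (q+3)) :
    A (vecCons f' (vecCons f (e ∘ k))) = 0 := by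
  by_cases hk : Function.Injective k
  · obtain ⟨i, hi⟩ := np_compl k (by omega)
    have h1 := np_cons_inj k hk i hi
    obtain ⟨j, hj⟩ := np_compl (vecCons i k) (by omega)
    have h2 := np_perm_ne A e he _ (np_cons_inj _ h1 j hj)
    obtain ⟨x, c, rfl⟩ : ∃ x c, k = vecCons x c := ⟨k 0, Fin.tail k, (Fin.cons_self_tail k).symm⟩
    simp only [np_comp_cons] at h2 ⊢
    have h3 := np_Q A hA e f f' hf j i x c (by
      rw [np_alt_swap, np_alt_swap', neg_neg]; exact h2)
    rw [np_alt_swap', np_alt_swap, h3]; simp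
  · rw [Function.Injective] at hk
    push Not at hk
    obtain ⟨a, b, hab, hne⟩ := hk
    exact A.map_eq_zero_of_eq _ (i := a.succ.succ) (j := b.succ.succ) (by simp [hab])
      (by simpa using hne)

lemma np_dec {q : ℕ} (A : D [⋀^Fin (q+3)]→ₗ[ℝ] ℝ) (e : Fin (q+3) → D)
    (he : A e ≠ 0) (β : D) : ∃ (c : Fin (q+3) → ℝ) (f : D), NPF A e f ∧ β = ∑ k, c k • e k + f := by
  refine ⟨fun k => A (Function.update e k β) / A e, β - ∑ k, (A (Function.update e k β) / A e) • e k,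
    ?_, by simp⟩
  intro k
  have hl : ∀ x, A (vecCons x (e ∘ k)) = npEv A (e ∘ k) x := fun x => rfl
  rw [hl, map_sub, map_sum]
  simp only [map_smul, smul_eq_mul]
  simp only [← hl]
  by_cases hk : Function.Injective k
  · obtain ⟨i, hi⟩ := np_compl k (by omega)
    have h1 := np_cons_inj k hk i hi
    let σ := Equiv.ofBijective (vecCons i k) (Finite.injective_iff_bijective.1 h1)
    have hs : ⇑σ = vecCons i k := rfl
    have h2 := A.map_perm e σ
    have h3 := A.map_perm (Function.update e i β) σ
    rw [hs, np_comp_cons] at h2 h3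
    have h4 : Function.update e i β ∘ k = e ∘ k := by
      ext r; simp [Function.update_of_ne (hi r)]
    rw [h4] at h3
    simp only [Function.update_self] at h3
    rw [Finset.sum_eq_single i, h2, h3]
    · rcases Int.units_eq_one_or (Equiv.Perm.sign σ) with h | h <;> simp [h] <;> field_simp <;> simp
    · intro b _ hb
      obtain ⟨j, hj⟩ : ∃ j, vecCons i k j = b := σ.surjective b
      revert hj
      refine Fin.cases ?_ (fun j => ?_) j
      · intro hj; exact absurd hj.symm hb
      · intro hj
        rw [np_alt_mem A _ _ j (by simpa using congrArg e hj)]; simp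
    · simp
  · rw [Function.Injective] at hk
    push Not at hk
    obtain ⟨a, b, hab, hne⟩ := hk
    have : ∀ x, A (vecCons x (e ∘ k)) = 0 := fun x =>
      A.map_eq_zero_of_eq _ (i := a.succ) (j := b.succ) (by simp [hab])
      (by simpa using hne)
    simp [this]

lemma np_Q2 {q : ℕ} (A : D [⋀^Fin (q+3)]→ₗ[ℝ] ℝ) (hA : NPQuad A) (e : Fin (q+3) → D)
    (he : A e ≠ 0) (i : Fin (q+3)) (f γ : D) (hf : NPF A e f) (g : Fin (q+1) → D)
    (hg : ∀ r, NPF A e (g r) ∨ ∃ j, j ≠ i ∧ ∃ c : ℝ, g r = c • e j) :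
    A (vecCons γ (vecCons f g)) = 0 := by
  obtain ⟨k, hk⟩ : ∃ k : Fin (q+2) → Fin (q+3), k = i.succAbove := ⟨_, rfl⟩
  have hki : Function.Injective k := hk ▸ Fin.succAbove_right_injective
  have hne := np_perm_ne A e he _ (np_cons_inj k hki i (by intro r; rw [hk]; exact Fin.succAbove_ne i r))
  rw [np_comp_cons] at hne
  have h := hA (e ∘ k) (vecCons (e i) g) γ f
  rw [Fin.sum_univ_succ] at h
  have h1 : ∀ r, A (vecCons (g r) (e ∘ k)) = 0 := by
    intro r
    rcases hg r with h | ⟨j, hj, c, hc⟩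
    · exact h k
    · rw [hc]
      have hl : ∀ x, A (vecCons x (e ∘ k)) = A.curryLeft x (e ∘ k) := fun x => rfl
      rw [hl, map_smul, AlternatingMap.smul_apply, ← hl]
      obtain ⟨s, hs⟩ := Fin.exists_succAbove_eq hj
      rw [np_alt_mem A _ _ s (by simp [hk, hs])]; simp
  have h2 : ∀ s : Fin (q+2), A (vecCons γ (vecCons f (s.removeNth (e ∘ k)))) = 0 := by
    intro s
    exact np_Q1 A hA e he f γ hf (k ∘ s.succAbove)
  have h3 : Function.update (vecCons (e i) g) 0 f = vecCons f g := by
    ext r; refine Fin.cases ?_ (fun r => ?_) r <;> simp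
  simp only [cons_val_succ, h1, h2, h3, cons_val_zero] at h
  simp at h
  exact h.resolve_left hne

lemma np_rad {q : ℕ} (A : D [⋀^Fin (q+3)]→ₗ[ℝ] ℝ) (hA : NPQuad A) (e : Fin (q+3) → D)
    (he : A e ≠ 0) (f : D) (hf : NPF A e f) (v : Fin (q+3) → D) (r : Fin (q+3)) (hr : v r = f) :
    A v = 0 := by
  have key : ∀ (γ : D) (g : Fin (q+1) → D), A (vecCons γ (vecCons f g)) = 0 := by
    intro γ g
    choose c f' hf' hd using fun r => np_dec A e he (g r)
    let u : Fin (q+1) → Option (Fin (q+3)) → D := fun r o =>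
      o.elim (f' r) (fun k => c r k • e k)
    have hu : g = fun r => ∑ o, u r o := by
      ext r
      rw [Fintype.sum_option]
      rw [hd r, add_comm]
      rfl
    have hl : ∀ g, A (vecCons γ (vecCons f g)) = (A.curryLeft γ).curryLeft f g := fun g => rfl
    rw [hu, hl, ← AlternatingMap.coe_multilinearMap, MultilinearMap.map_sum]
    refine Finset.sum_eq_zero fun s _ => ?_
    rw [AlternatingMap.coe_multilinearMap, ← hl]
    obtain ⟨i, hi⟩ := np_compl (fun r => (s r).getD 0) (by omega : q+1 < q+3)
    refine np_Q2 A hA e he i f γ hf _ fun r => ?_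
    have := hi r
    cases hs : s r with
    | none => left; simp only [u]; exact hf' r
    | some k => right; exact ⟨k, by simpa [hs] using this, c r k, rfl⟩
  by_cases h0 : r = 0
  · have : v = vecCons (v 0) (vecCons (v 1) (fun i => v i.succ.succ)) := by
      ext r; refine Fin.cases ?_ (fun r => Fin.cases ?_ (fun r => ?_) r) r <;> simp
    rw [this, np_alt_swap, ← h0, hr, key]; simp
  · have h1 : r ≠ 1 → v ∘ Equiv.swap 1 r = v ∘ Equiv.swap 1 r := fun _ => rfl
    have h2 := A.map_perm v (Equiv.swap 1 r)
    have h3 : v ∘ Equiv.swap 1 r = vecCons (v 0) (vecCons f (fun i => v (Equiv.swap 1 r i.succ.succ))) := by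
      ext i; refine Fin.cases ?_ (fun i => Fin.cases ?_ (fun i => ?_) i) i
      · simp [Equiv.swap_apply_of_ne_of_ne (a := (1 : Fin (q+3))) (b := r) (x := 0) (by simp) (Ne.symm h0)]
      · simp [hr]
      · simp
    rw [h3, key] at h2
    rcases Int.units_eq_one_or (Equiv.Perm.sign (Equiv.swap 1 r)) with h | h <;> rw [h] at h2 <;> simpa using h2.symm

lemma np_main {q : ℕ} (A : D [⋀^Fin (q+3)]→ₗ[ℝ] ℝ) (hA : NPQuad A) {ι : Type*} (b : ι → D) :
    ∃ (w : Fin (q+3) → ι → ℝ) (C : (Fin (q+3) → Fin (q+3)) → ℝ),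
      ∀ I : Fin (q+3) → ι, A (b ∘ I) = ∑ k, C k * ∏ r, w (k r) (I r) := by
  by_cases h : A = 0
  · exact ⟨0, 0, by simp [h]⟩
  obtain ⟨e, he⟩ : ∃ e, A e ≠ 0 := by
    by_contra hc
    push Not at hc
    exact h (by ext v; simp [hc])
  choose c f hf hd using fun i => np_dec A e he (b i)
  refine ⟨fun k i => c i k, fun k => A (e ∘ k), fun I => ?_⟩
  have h1 : b ∘ I = (fun r => ∑ k, c (I r) k • e k) + (fun r => f (I r)) := by
    ext r; simp [hd (I r)]
  rw [h1, ← AlternatingMap.coe_multilinearMap, MultilinearMap.map_add_univ,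
    Finset.sum_eq_single Finset.univ]
  · rw [Finset.piecewise_univ, MultilinearMap.map_sum]
    refine Finset.sum_congr rfl fun k _ => ?_
    rw [MultilinearMap.map_smul_univ, smul_eq_mul, mul_comm]; rfl
  · intro s _ hs
    obtain ⟨r, hr⟩ : ∃ r, r ∉ s := by
      by_contra hc; push Not at hc; exact hs (Finset.eq_univ_iff_forall.2 hc)
    exact np_rad A hA e he (f (I r)) (hf _) _ r (by simp [hr])
  · simp
end AlgPart

section ArrPart
/-- coordinate covector -/
abbrev npdx {n : ℕ} (k : Fin n) : Fin n → ℝ := Pi.single k 1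

lemma np_expand {n m : ℕ} (M : (Fin n → ℝ) [⋀^Fin m]→ₗ[ℝ] ℝ) (α : Fin m → Fin n → ℝ) :
    M α = ∑ K : Fin m → Fin n, (∏ r, α r (K r)) * M (npdx ∘ K) := by
  have h : α = fun r => ∑ k, α r k • (npdx k : Fin n → ℝ) := by
    ext r i; simp [Finset.sum_apply, npdx, Pi.single_apply]
  conv_lhs => rw [h, ← AlternatingMap.coe_multilinearMap, MultilinearMap.map_sum]
  refine Finset.sum_congr rfl fun k _ => ?_
  rw [MultilinearMap.map_smul_univ, smul_eq_mul]; rfl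

lemma np_pair {n m : ℕ} (M : (Fin n → ℝ) [⋀^Fin m]→ₗ[ℝ] ℝ) (α : Fin m → Fin n → ℝ) :
    (m.factorial : ℝ)⁻¹ * ∑ K : Fin m → Fin n,
      (Matrix.of fun i j => α i (K j)).det * M (npdx ∘ K) = M α := by
  have h : ∑ K : Fin m → Fin n, (Matrix.of fun i j => α i (K j)).det * M (npdx ∘ K)
      = m.factorial * M α := by
    simp only [Matrix.det_apply, Finset.sum_mul]
    rw [Finset.sum_comm]
    have : ∀ σ : Equiv.Perm (Fin m), ∑ K : Fin m → Fin n,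
        (Equiv.Perm.sign σ • ∏ i, (Matrix.of fun i j => α i (K j)) (σ i) i) * M (npdx ∘ K) = M α := by
      intro σ
      have h1 := np_expand M (α ∘ σ)
      rw [M.map_perm] at h1
      simp only [smul_mul_assoc, ← Finset.smul_sum]
      simp only [Function.comp_apply] at h1
      simp only [Matrix.of_apply]
      rw [← h1, smul_smul]
      simp
    rw [Finset.sum_congr rfl fun σ _ => this σ]
    simp [Fintype.card_perm]
  rw [h, inv_mul_cancel_left₀ (by positivity)]

/-- alternating map of an antisymmetric array -/
def npAlt {n m : ℕ} (T : (Fin m → Fin n) → ℝ)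
    (hT : ∀ a (σ : Equiv.Perm (Fin m)), T (a ∘ σ) = ((Equiv.Perm.sign σ : ℤ) : ℝ) * T a) :
    (Fin n → ℝ) [⋀^Fin m]→ₗ[ℝ] ℝ :=
  { (∑ a, T a • (MultilinearMap.mkPiAlgebra ℝ (Fin m) ℝ).compLinearMap
      (fun r => LinearMap.proj (a r)) : MultilinearMap ℝ (fun _ : Fin m => (Fin n → ℝ)) ℝ) with
    map_eq_zero_of_eq' := by
      intro v i j hv hij
      change (∑ a, T a • (MultilinearMap.mkPiAlgebra ℝ (Fin m) ℝ).compLinearMap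
      (fun r => LinearMap.proj (a r)) : MultilinearMap ℝ (fun _ : Fin m => (Fin n → ℝ)) ℝ) v = 0
      simp only [_root_.sum_apply, _root_.smul_apply,
        MultilinearMap.compLinearMap_apply, MultilinearMap.mkPiAlgebra_apply, LinearMap.proj_apply,
        smul_eq_mul]
      have h : ∑ a, T a * ∏ r, v r (a r) = - ∑ a, T a * ∏ r, v r (a r) := by
        conv_lhs => rw [← (Equiv.arrowCongr (Equiv.swap i j) (Equiv.refl (Fin n))).sum_comp]
        rw [← Finset.sum_neg_distrib]
        refine Finset.sum_congr rfl fun a _ => ?_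
        have h1 : (Equiv.arrowCongr (Equiv.swap i j) (Equiv.refl (Fin n))) a
          = a ∘ Equiv.swap i j := by ext r; simp [Equiv.arrowCongr]
        rw [h1, hT, Equiv.Perm.sign_swap hij]
        rw [← Equiv.prod_comp (Equiv.swap i j) (fun r => v r (a r))] 
        have h2 : ∀ r, v (Equiv.swap i j r) = v r := by
          intro r
          by_cases h1 : r = i
          · subst h1; simp [hv]
          by_cases h2 : r = j
          · subst h2; simp [hv]
          rw [Equiv.swap_apply_of_ne_of_ne h1 h2]
        simp [h2]
      linarith }

lemma npAlt_apply {n m : ℕ} (T : (Fin m → Fin n) → ℝ) (hT) (v : Fin m → Fin n → ℝ) :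
    npAlt T hT v = ∑ a, T a * ∏ r, v r (a r) := by
  change (∑ a, T a • (MultilinearMap.mkPiAlgebra ℝ (Fin m) ℝ).compLinearMap
      (fun r => LinearMap.proj (a r)) : MultilinearMap ℝ (fun _ : Fin m => (Fin n → ℝ)) ℝ) v = _
  simp only [_root_.sum_apply, _root_.smul_apply,
        MultilinearMap.compLinearMap_apply, MultilinearMap.mkPiAlgebra_apply, LinearMap.proj_apply,
        smul_eq_mul]

lemma npAlt_dx {n m : ℕ} (T : (Fin m → Fin n) → ℝ) (hT) (I : Fin m → Fin n) :
    npAlt T hT (npdx ∘ I) = T I := by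
  rw [npAlt_apply, Finset.sum_eq_single I]
  · simp
  · intro a _ ha
    obtain ⟨r, hr⟩ := Function.ne_iff.1 ha
    rw [Finset.prod_eq_zero (Finset.mem_univ r) (by simp [hr])]; simp
  · simp

lemma npdx_sum {n : ℕ} (δ : Fin n → ℝ) : δ = ∑ k, δ k • (npdx k : Fin n → ℝ) := by
  ext i; simp [Finset.sum_apply, Pi.single_apply]

/-- the array-level conclusion -/
lemma np_array {n q : ℕ} (A : (Fin n → ℝ) [⋀^Fin (q+3)]→ₗ[ℝ] ℝ) (hA : NPQuad A)
    (B : (Fin n → ℝ) [⋀^Fin (q+4)]→ₗ[ℝ] ℝ) (ξ η : (Fin (q+2) → Fin n) → ℝ) (i : Fin n)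
    (X Y : Fin n → ℝ)
    (hX : ∀ j, X j = ∑ K, ξ K * A (npdx ∘ vecCons j K))
    (hY : ∀ j, Y j = ∑ K, η K * A (npdx ∘ vecCons j K)) :
    ∑ K, B (vecCons X (vecCons Y (npdx ∘ K))) * A (npdx ∘ vecCons i K) = 0 := by
  obtain ⟨w, C, hw⟩ := np_main A hA npdx
  have hspan : ∀ (ξ : (Fin (q+2) → Fin n) → ℝ) (X : Fin n → ℝ)
      (_ : ∀ j, X j = ∑ K, ξ K * A (npdx ∘ vecCons j K)), X ∈ Submodule.span ℝ (Set.range w) := by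
    intro ξ X hX
    have : X = ∑ K, ∑ k : Fin (q+3) → Fin (q+3), (ξ K * C k * ∏ r : Fin (q+2), w (k r.succ) (K r)) • w (k 0) := by
      ext j
      rw [hX]
      simp only [Finset.sum_apply, hw, Fin.prod_univ_succ (n := q+2), Finset.mul_sum, Pi.smul_apply, smul_eq_mul,
        cons_val_zero, cons_val_succ]
      refine Finset.sum_congr rfl fun K _ => Finset.sum_congr rfl fun k _ => by ring
    rw [this]
    refine Submodule.sum_mem _ fun K _ => Submodule.sum_mem _ fun k _ => Submodule.smul_mem _ _ (Submodule.subset_span ⟨_, rfl⟩)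
  simp only [hw, Fin.prod_univ_succ (n := q+2), cons_val_zero, cons_val_succ, Finset.mul_sum]
  rw [Finset.sum_comm]
  refine Finset.sum_eq_zero fun k _ => ?_
  have h1 : B (vecCons X (vecCons Y (fun r : Fin (q+2) => w (k r.succ)))) = 0 := by
    apply AlternatingMap.map_linearDependent
    intro hli
    have hle : Submodule.span ℝ (Set.range (vecCons X (vecCons Y (fun r : Fin (q+2) => w (k r.succ))))) ≤
        Submodule.span ℝ (Set.range w) := by
      rw [Submodule.span_le]
      rintro _ ⟨r, rfl⟩
      refine Fin.cases ?_ (fun r => Fin.cases ?_ (fun r => ?_) r) r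
      · exact hspan ξ X hX
      · exact hspan η Y hY
      · exact Submodule.subset_span ⟨_, rfl⟩
    have h2 := Submodule.finrank_mono hle
    rw [finrank_span_eq_card hli] at h2
    have h3 := finrank_range_le_card (R := ℝ) w
    rw [Set.finrank] at h3
    simp at h2 h3
    omega
  have h2 := np_expand ((B.curryLeft X).curryLeft Y) (fun r : Fin (q+2) => w (k r.succ))
  have h3 : ∀ v, ((B.curryLeft X).curryLeft Y) v = B (vecCons X (vecCons Y v)) := fun v => rfl
  simp only [h3] at h2
  rw [h1] at h2
  rw [← mul_zero (C k * w (k 0) i), h2, Finset.mul_sum]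
  refine Finset.sum_congr rfl fun K _ => by ring
end ArrPart

section GeoPart
lemma np_quad_dx {n q : ℕ}
    (P : Tens n (q + 3)) (hPs : SmoothT P) (hPa : AltT P)
    (H : Tens n (q + 4))
    (htw : ∀ ξ η : Tens n (q + 2), SmoothT ξ → AltT ξ → SmoothT η → AltT η →
      sharp (lieDV (sharp P ξ) P) η =
        -(sharp P (iV (sharp P η) (dT ξ - iV (sharp P ξ) H)))) (x : Pt n)
    (A : (Fin n → ℝ) [⋀^Fin (q+3)]→ₗ[ℝ] ℝ) (hA : ∀ I, A (npdx ∘ I) = P x I)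
    (α β : Fin (q+2) → Pt n) (δ : Pt n) (i : Fin n) :
    npC A (npEv A α) δ (vecCons (npdx i) β) =
      ∑ s : Fin (q+3), (-1:ℝ)^(s:ℕ) * (A (vecCons ((vecCons δ α : Fin (q+3) → Pt n) s) β) *
        A (vecCons (npdx i) (s.removeNth (vecCons δ α : Fin (q+3) → Pt n)))) := by
  obtain ⟨f, hf⟩ : ∃ f : Pt n → ℝ, f = fun y => ∑ j, δ j * (y j - x j) := ⟨_, rfl⟩
  have hf0 : f x = 0 := by simp [hf]
  have hfs : ContDiff ℝ (⊤ : ℕ∞) f := by rw [hf]; fun_prop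
  have hfd : ∀ j, pd j f x = δ j := by
    intro j
    have h : HasFDerivAt f (∑ j, δ j • (ContinuousLinearMap.proj j : (Fin n → ℝ) →L[ℝ] ℝ)) x := by
      rw [hf]
      refine HasFDerivAt.fun_sum fun j _ => ?_
      exact ((ContinuousLinearMap.proj (R := ℝ) (φ := fun _ : Fin n => ℝ) j).hasFDerivAt.sub_const (x j)).const_mul (δ j)
    rw [pd, h.fderiv]
    simp [Pi.single_apply]
  have hpd : ∀ (g : Pt n → ℝ), ContDiff ℝ (⊤ : ℕ∞) g → ∀ j, pd j (fun y => f y * g y) x = δ j * g x := by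
    intro g hg j
    have h1 : DifferentiableAt ℝ f x := hfs.differentiable (by simp) x
    have h2 : DifferentiableAt ℝ g x := hg.differentiable (by simp) x
    have := fderiv_fun_mul h1 h2
    rw [pd, this, ← hfd j, pd, hf0]
    simp [mul_comm]
  have hdalt : ∀ (α : Fin (q+2) → Pt n) (a : Fin (q+2) → Fin n) (σ : Equiv.Perm (Fin (q+2))),
      (Matrix.of fun i j => α i ((a ∘ σ) j)).det =
        ((Equiv.Perm.sign σ : ℤ) : ℝ) * (Matrix.of fun i j => α i (a j)).det := by
    intro α a σ
    exact Matrix.det_permute' σ (Matrix.of fun i j => α i (a j))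
  obtain ⟨ξ0, hξ0⟩ : ∃ ξ0 : (Fin (q+2) → Fin n) → ℝ,
    ξ0 = fun K => (Matrix.of fun i j => α i (K j)).det := ⟨_, rfl⟩
  obtain ⟨η0, hη0⟩ : ∃ η0 : (Fin (q+2) → Fin n) → ℝ,
    η0 = fun K => (Matrix.of fun i j => β i (K j)).det := ⟨_, rfl⟩
  have h := htw (fun y K => f y * ξ0 K) (fun y K => η0 K)
    (fun a => hfs.mul contDiff_const)
    (fun y a σ => by rw [hξ0]; simp only [hdalt]; ring)
    (fun a => contDiff_const)
    (fun y a σ => by rw [hη0]; simp only [hdalt])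
  have h := congrFun (congrFun h x) i
  have hsh : ∀ (α : Fin (q+2) → Pt n) (j : Fin n), ((q+2).factorial : ℝ)⁻¹ *
      ∑ K : Fin (q+2) → Fin n, (Matrix.of fun i j => α i (K j)).det * P x (Fin.cons j K)
      = A (vecCons (npdx j) α) := by
    intro α j
    have := np_pair (A.curryLeft (npdx j)) α
    rw [← AlternatingMap.curryLeft_apply_apply, ← this]
    congr 1
    refine Finset.sum_congr rfl fun K _ => ?_
    rw [AlternatingMap.curryLeft_apply_apply, ← np_comp_cons, hA]; rfl
  obtain ⟨V, hV⟩ : ∃ V : VF n, V = fun y j => ((q+2).factorial : ℝ)⁻¹ *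
      ∑ K : Fin (q+2) → Fin n, ξ0 K * P y (Fin.cons j K) := ⟨_, rfl⟩
  have hVx : ∀ j, V x j = A (vecCons (npdx j) α) := by
    intro j; rw [hV, hξ0]; exact hsh α j
  have hVs : ∀ j, ContDiff ℝ (⊤ : ℕ∞) (fun y => V y j) := by
    intro j
    rw [hV]
    exact contDiff_const.mul (ContDiff.sum fun K _ => contDiff_const.mul (hPs _))
  have hshV : sharp P (fun y K => f y * ξ0 K) = fun y j => f y * V y j := by
    ext y j
    simp only [sharp, hV, Finset.mul_sum]
    refine Finset.sum_congr rfl fun K _ => by ring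
  have hW : ∀ j, sharp P (fun y K => η0 K) x j = A (vecCons (npdx j) β) := by
    intro j; rw [hη0]; exact hsh β j
  have hV0 : (fun j => f x * V x j) = 0 := by ext j; simp [hf0]
  have hupd : ∀ (a : Fin (q+3) → Fin n) (r : Fin (q+3)),
      A (Function.update (npdx ∘ a) r δ) = ∑ j, δ j * P x (Function.update a r j) := by
    intro a r
    conv_lhs => rw [npdx_sum δ]
    rw [AlternatingMap.map_update_sum]
    refine Finset.sum_congr rfl fun j _ => ?_
    rw [AlternatingMap.map_update_smul, smul_eq_mul, ← hA, Function.comp_update]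
  have hL : ∀ a, lieDV (sharp P (fun y K => f y * ξ0 K)) P x a = - npC A (npEv A α) δ (npdx ∘ a) := by
    intro a
    rw [hshV, npC_apply]
    simp only [lieDV]
    rw [hV0]
    simp only [map_zero, zero_sub, hpd _ (hVs _), hupd]
    congr 1
    refine Finset.sum_congr rfl fun r _ => ?_
    rw [Finset.mul_sum]
    refine Finset.sum_congr rfl fun j _ => ?_
    rw [hVx]
    have : npEv A α ((npdx ∘ a) r) = A (vecCons (npdx (a r)) α) := rfl
    rw [this]; ring
  have hlhs : sharp (lieDV (sharp P (fun y K => f y * ξ0 K)) P) (fun y K => η0 K) x i =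
      - npC A (npEv A α) δ (vecCons (npdx i) β) := by
    have := np_pair ((npC A (npEv A α) δ).curryLeft (npdx i)) β
    rw [← AlternatingMap.curryLeft_apply_apply, ← this]
    simp only [sharp, hL, hη0]
    rw [← mul_neg, ← Finset.sum_neg_distrib]
    congr 1
    refine Finset.sum_congr rfl fun K _ => ?_
    rw [AlternatingMap.curryLeft_apply_apply, ← np_comp_cons, mul_neg]; rfl
  have hd : ∀ a, (dT (fun y K => f y * ξ0 K) - iV (sharp P (fun y K => f y * ξ0 K)) H) x a =
      (Matrix.of fun i j => (vecCons δ α : Fin (q+3) → Pt n) i (a j)).det := by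
    intro a
    rw [hshV]
    simp only [Pi.sub_apply, iV, dT, hf0]
    rw [Matrix.det_succ_row_zero]
    simp only [hpd _ contDiff_const, zero_mul, Finset.sum_const_zero, sub_zero]
    refine Finset.sum_congr rfl fun s _ => ?_
    rw [hξ0, mul_assoc]; rfl
  have hi : ∀ K, iV (sharp P (fun y K => η0 K))
      (dT (fun y K => f y * ξ0 K) - iV (sharp P (fun y K => f y * ξ0 K)) H) x K =
      ∑ s : Fin (q+3), (-1:ℝ)^(s:ℕ) * A (vecCons ((vecCons δ α : Fin (q+3) → Pt n) s) β) *
       (Matrix.of fun i j => (s.removeNth (vecCons δ α : Fin (q+3) → Pt n)) i (K j)).det := by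
    intro K
    have h1 : ∀ (Z : VF n) (ω : Tens n (q+3)), iV Z ω x K = ∑ l, Z x l * ω x (Fin.cons l K) :=
      fun Z ω => rfl
    rw [h1]
    simp only [hd, hW]
    simp only [Matrix.det_succ_column_zero (n := q+2), Finset.mul_sum]
    rw [Finset.sum_comm]
    refine Finset.sum_congr rfl fun s _ => ?_
    have h2 : A (vecCons ((vecCons δ α : Fin (q+3) → Pt n) s) β) =
        ∑ l, (vecCons δ α : Fin (q+3) → Pt n) s l * A (vecCons (npdx l) β) := by
      have hl : ∀ z, A (vecCons z β) = npEv A β z := fun z => rfl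
      simp only [hl]
      conv_lhs => rw [npdx_sum ((vecCons δ α : Fin (q+3) → Pt n) s), map_sum]
      simp only [map_smul, smul_eq_mul]
    rw [h2, Finset.mul_sum, Finset.sum_mul]
    refine Finset.sum_congr rfl fun l _ => ?_
    have h3 : ((Matrix.of fun i j => (vecCons δ α : Fin (q+3) → Pt n) i
        ((Fin.cons l K : Fin (q+3) → Fin n) j)).submatrix s.succAbove Fin.succ) =
        (Matrix.of fun i j => (s.removeNth (vecCons δ α : Fin (q+3) → Pt n)) i (K j)) := rfl
    rw [h3]
    simp only [Matrix.of_apply, Fin.cons_zero]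
    ring
  rw [hlhs, Pi.neg_apply, Pi.neg_apply, neg_inj] at h
  rw [h]
  have h1 : ∀ (ζ : Tens n (q+2)), sharp P ζ x i = ((q+2).factorial : ℝ)⁻¹ *
      ∑ K, ζ x K * P x (Fin.cons i K) := fun ζ => rfl
  rw [h1]
  simp only [hi, Finset.sum_mul]
  rw [Finset.sum_comm, Finset.mul_sum]
  refine Finset.sum_congr rfl fun s _ => ?_
  rw [← hsh]
  simp only [Finset.mul_sum]
  refine Finset.sum_congr rfl fun K _ => by ring

lemma np_quad_s15 {n q : ℕ}
    (P : Tens n (q + 3)) (hPs : SmoothT P) (hPa : AltT P)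
    (H : Tens n (q + 4))
    (htw : ∀ ξ η : Tens n (q + 2), SmoothT ξ → AltT ξ → SmoothT η → AltT η →
      sharp (lieDV (sharp P ξ) P) η =
        -(sharp P (iV (sharp P η) (dT ξ - iV (sharp P ξ) H)))) (x : Pt n)
    (A : (Fin n → ℝ) [⋀^Fin (q+3)]→ₗ[ℝ] ℝ) (hA : ∀ I, A (npdx ∘ I) = P x I) : NPQuad A := by
  intro α β γ δ
  have h : npEv (npC A (npEv A α) δ) β =
      ∑ s : Fin (q+3), ((-1:ℝ)^(s:ℕ) * (A (vecCons ((vecCons δ α : Fin (q+3) → Pt n) s) β))) •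
        npEv A (s.removeNth (vecCons δ α : Fin (q+3) → Pt n)) := by
    refine (Pi.basisFun ℝ (Fin n)).ext fun i => ?_
    have := np_quad_dx P hPs hPa H htw x A hA α β δ i
    rw [Pi.basisFun_apply]
    simp only [LinearMap.sum_apply, LinearMap.smul_apply, smul_eq_mul, mul_assoc]
    exact this
  have h := congrArg (fun L => L γ) h
  simp only [LinearMap.sum_apply, LinearMap.smul_apply, smul_eq_mul] at h
  have hl : ∀ (M : (Fin n → ℝ) [⋀^Fin (q+3)]→ₗ[ℝ] ℝ) β z, npEv M β z = M (vecCons z β) :=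
    fun M β z => rfl
  simp only [hl, npC_apply] at h
  rw [Fin.sum_univ_succ (n := q+2), Fin.sum_univ_succ (n := q+2)] at h
  have h1 : Function.update (vecCons γ β : Fin (q+3) → Pt n) 0 δ = vecCons δ β := by
    ext r; refine Fin.cases ?_ (fun r => ?_) r <;> simp
  have h2 : (Fin.removeNth 0 (vecCons δ α : Fin (q+3) → Pt n)) = α := rfl
  have h3 : ∀ r : Fin (q+2), Function.update (vecCons γ β : Fin (q+3) → Pt n) r.succ δ =
      vecCons γ (Function.update β r δ) := by
    intro r
    exact (Fin.cons_update (α := fun _ => Pt n) γ β r δ).symm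
  have h4 : ∀ s : Fin (q+2), (Fin.removeNth s.succ (vecCons δ α : Fin (q+3) → Pt n)) =
      vecCons δ (s.removeNth α) := by
    intro s
    ext r : 1; refine Fin.cases ?_ (fun r => ?_) r <;> simp [Fin.removeNth]
  simp only [h1, h2, h3, h4, cons_val_zero, cons_val_succ, Fin.val_zero, pow_zero, one_mul,
    Fin.val_succ, pow_succ] at h
  have h5 : ∀ a b c : ℝ, a * (-1) * b * c = -(a * (b * c)) := fun a b c => by ring
  simp only [h5, Finset.sum_neg_distrib] at h
  linarith [mul_comm (A (vecCons γ α)) (A (vecCons δ β))]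
end GeoPart

end NPAux

/-- For `p > 1`, twisted Nambu–Poisson structures are
redundant: if `H` is a closed `(p+2)`-form and the `(p+1)`-vector field `Π`
satisfies the `H`-twisted condition
`(L_{Π^#(ξ)}Π)^#(η) = −Π^#( i_{Π^#(η)}( dξ − i_{Π^#(ξ)}H ) )` for all
`p`-forms `ξ, η`, then `Π` also satisfies the untwisted condition
`(L_{Π^#(ξ)}Π)^#(η) = −Π^#( i_{Π^#(η)}(dξ) )` for all `p`-forms `ξ, η`;
that is, `Π` is an ordinary Nambu–Poisson structure.
(Here `p = q + 2 > 1`.) -/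
theorem twisted_nambu_poisson_redundant {n q : ℕ}
    (P : Tens n (q + 3)) (hPs : SmoothT P) (hPa : AltT P)
    (H : Tens n (q + 4)) (hHs : SmoothT H) (hHa : AltT H) (hHcl : dT H = 0)
    (htw : ∀ ξ η : Tens n (q + 2), SmoothT ξ → AltT ξ → SmoothT η → AltT η →
      sharp (lieDV (sharp P ξ) P) η =
        -(sharp P (iV (sharp P η) (dT ξ - iV (sharp P ξ) H)))) :
    ∀ ξ η : Tens n (q + 2), SmoothT ξ → AltT ξ → SmoothT η → AltT η →
      sharp (lieDV (sharp P ξ) P) η =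
        -(sharp P (iV (sharp P η) (dT ξ))) := by
  intro ξ η hξs hξa hηs hηa
  rw [htw ξ η hξs hξa hηs hηa]
  ext x i
  have hA := npAlt_dx (P x) (hPa x)
  have hB := npAlt_dx (H x) (hHa x)
  have hq := np_quad_s15 P hPs hPa H htw x (npAlt (P x) (hPa x)) hA
  have hX : ∀ (ξ : Tens n (q+2)) (j : Fin n), sharp P ξ x j = ∑ K, (((q+2).factorial : ℝ)⁻¹ * ξ x K) *
      npAlt (P x) (hPa x) (npdx ∘ Matrix.vecCons j K) := by
    intro ξ j
    simp only [hA, sharp, Finset.mul_sum, mul_assoc]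
    rfl
  have h := np_array _ hq (npAlt (H x) (hHa x)) _ _ i _ _ (hX ξ) (hX η)
  have hH : ∀ K, npAlt (H x) (hHa x) (Matrix.vecCons (sharp P ξ x) (Matrix.vecCons (sharp P η x) (npdx ∘ K)))
      = iV (sharp P η) (iV (sharp P ξ) H) x K := by
    intro K
    have hl : ∀ z y, npAlt (H x) (hHa x) (Matrix.vecCons z (Matrix.vecCons y (npdx ∘ K))) =
      npEv ((npAlt (H x) (hHa x)).curryLeft z) (npdx ∘ K) y := fun z y => rfl
    have hl2 : ∀ z v, npAlt (H x) (hHa x) (Matrix.vecCons z v) =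
      npEv (npAlt (H x) (hHa x)) v z := fun z y => rfl
    rw [hl]
    conv_lhs => rw [npdx_sum (sharp P η x), map_sum]
    simp only [map_smul, smul_eq_mul]
    simp only [← hl, iV]
    refine Finset.sum_congr rfl fun l _ => ?_
    congr 1
    rw [hl2]
    conv_lhs => rw [npdx_sum (sharp P ξ x), map_sum]
    simp only [map_smul, smul_eq_mul]
    simp only [← hl2, ← np_comp_cons, hB]
    rfl
  simp only [hH, hA] at h
  have hs : sharp P (iV (sharp P η) (dT ξ - iV (sharp P ξ) H)) x i =
      sharp P (iV (sharp P η) (dT ξ)) x i - ((q+2).factorial : ℝ)⁻¹ *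
       ∑ K, iV (sharp P η) (iV (sharp P ξ) H) x K * P x (Matrix.vecCons i K) := by
    have h1 : ∀ K, iV (sharp P η) (dT ξ - iV (sharp P ξ) H) x K =
      iV (sharp P η) (dT ξ) x K - iV (sharp P η) (iV (sharp P ξ) H) x K := by
      intro K
      simp only [iV, Pi.sub_apply, mul_sub, Finset.sum_sub_distrib]
    rw [sharp, sharp, ← mul_sub, ← Finset.sum_sub_distrib]
    congr 1
    refine Finset.sum_congr rfl fun K _ => ?_
    rw [h1, sub_mul]; rfl
  rw [Pi.neg_apply, Pi.neg_apply, Pi.neg_apply, Pi.neg_apply, hs, h]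
  simp
end
end

section
/- The higher open–closed relations can be inverted: with g = (G^{-1} + Π G̃ Πᵀ)^{-1}, g̃ = (G̃^{-1} + Πᵀ G Π)^{-1}, and C = −g Π G̃, one has G = g + C g̃^{-1} Cᵀ and G̃ = g̃ + Cᵀ g^{-1} C. -/
open Matrix

/-- The higher open–closed relations can be inverted: with
`g = (G⁻¹ + Π G̃ Πᵀ)⁻¹`, `g̃ = (G̃⁻¹ + Πᵀ G Π)⁻¹` and `C = −g Π G̃`, one has
`G = g + C g̃⁻¹ Cᵀ` and `G̃ = g̃ + Cᵀ g⁻¹ C`. -/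
theorem open_closed_relations_inverted {n N : ℕ} (hn : 0 < n) (hN : 0 < N)
    (G : Matrix (Fin n) (Fin n) ℝ) (Gt : Matrix (Fin N) (Fin N) ℝ)
    (P : Matrix (Fin n) (Fin N) ℝ) (hG : G.PosDef) (hGt : Gt.PosDef)
    (g : Matrix (Fin n) (Fin n) ℝ) (gt : Matrix (Fin N) (Fin N) ℝ)
    (C : Matrix (Fin n) (Fin N) ℝ)
    (hg : g = (G⁻¹ + P * Gt * Pᵀ)⁻¹) (hgt : gt = (Gt⁻¹ + Pᵀ * G * P)⁻¹)
    (hC : C = -(g * P * Gt)) :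
    G = g + C * gt⁻¹ * Cᵀ ∧ Gt = gt + Cᵀ * g⁻¹ * C := by
  have hGs : Gᵀ = G := by simpa using hG.isHermitian.eq
  have hGts : Gtᵀ = Gt := by simpa using hGt.isHermitian.eq
  have hM : (G⁻¹ + P * Gt * Pᵀ).PosDef :=
    hG.inv.add_posSemidef (by simpa using hGt.posSemidef.mul_mul_conjTranspose_same P)
  have hK : (Gt⁻¹ + Pᵀ * G * P).PosDef :=
    hGt.inv.add_posSemidef (by simpa using hG.posSemidef.conjTranspose_mul_mul_same P)
  have uG := (Matrix.isUnit_iff_isUnit_det _).1 hG.isUnit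
  have uGt := (Matrix.isUnit_iff_isUnit_det _).1 hGt.isUnit
  have uM := (Matrix.isUnit_iff_isUnit_det _).1 hM.isUnit
  have uK := (Matrix.isUnit_iff_isUnit_det _).1 hK.isUnit
  have hMs : (G⁻¹ + P * Gt * Pᵀ)ᵀ = G⁻¹ + P * Gt * Pᵀ := by simpa using hM.isHermitian.eq
  have key : P * Gt * (Gt⁻¹ + Pᵀ * G * P) = (G⁻¹ + P * Gt * Pᵀ) * (G * P) := by
    rw [Matrix.mul_add, Matrix.add_mul, Matrix.mul_nonsing_inv_cancel_right _ _ uGt,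
      Matrix.nonsing_inv_mul_cancel_left _ _ uG]
    simp only [Matrix.mul_assoc]
  have e1 : P * Gt * Pᵀ = (G⁻¹ + P * Gt * Pᵀ) - G⁻¹ := by abel
  have e2 : Pᵀ * G * P = (Gt⁻¹ + Pᵀ * G * P) - Gt⁻¹ := by abel
  generalize G⁻¹ + P * Gt * Pᵀ = M at *
  generalize Gt⁻¹ + Pᵀ * G * P = K at *
  have hgs : gᵀ = g := by rw [hg, Matrix.transpose_nonsing_inv, hMs]
  have hgi : g⁻¹ = M := by rw [hg, Matrix.nonsing_inv_nonsing_inv _ uM]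
  have hgti : gt⁻¹ = K := by rw [hgt, Matrix.nonsing_inv_nonsing_inv _ uK]
  have Mg : M * g = 1 := by rw [hg, Matrix.mul_nonsing_inv _ uM]
  have gM : g * M = 1 := by rw [hg, Matrix.nonsing_inv_mul _ uM]
  have Kgt : K * gt = 1 := by rw [hgt, Matrix.mul_nonsing_inv _ uK]
  have hCt : Cᵀ = -(Gt * Pᵀ * g) := by
    rw [hC]; simp [Matrix.transpose_mul, hgs, hGts, Matrix.mul_assoc]
  have hCK : C * K = -(G * P) := by
    rw [hC, Matrix.neg_mul, Matrix.mul_assoc g, Matrix.mul_assoc g, key, ← Matrix.mul_assoc g, gM,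
      Matrix.one_mul]
  have hC2 : C = -(G * P * gt) := by
    rw [← Matrix.neg_mul, ← hCK, Matrix.mul_assoc, Kgt, Matrix.mul_one]
  constructor
  · have : C * K * Cᵀ = G * (P * Gt * Pᵀ) * g := by
      rw [hCK, hCt, Matrix.neg_mul, Matrix.mul_neg, neg_neg]; simp only [Matrix.mul_assoc]
    rw [hgti, this, e1, Matrix.mul_sub, Matrix.mul_nonsing_inv _ uG, Matrix.sub_mul,
      Matrix.mul_assoc, Mg, Matrix.mul_one, Matrix.one_mul]
    abel
  · have : Cᵀ * M * C = Gt * (Pᵀ * G * P) * gt := by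
      rw [hCt, Matrix.neg_mul, Matrix.mul_assoc _ g, gM, Matrix.mul_one, hC2, Matrix.neg_mul, Matrix.mul_neg, neg_neg]
      simp only [Matrix.mul_assoc]
    rw [hgi, this, e2, Matrix.mul_sub, Matrix.mul_nonsing_inv _ uGt, Matrix.sub_mul,
      Matrix.mul_assoc, Kgt, Matrix.mul_one, Matrix.one_mul]
    abel
end

section
/- For any real n×N matrix B, the (n+N)×(n+N) block matrix 𝐀 = [[Iₙ, B], [−Πᵀ, I_N − Πᵀ B]] is invertible, and the twisted higher generalized metric factorizes through the open variables: 𝐀ᵀ · diag(G^{-1}, G̃) · 𝐀 = 𝐚ᵀ · diag(g^{-1}, g̃) · 𝐚, where 𝐚 = [[Iₙ, B + C], [0, I_N]], g = (G^{-1} + Π G̃ Πᵀ)^{-1}, g̃ = (G̃^{-1} + Πᵀ G Π)^{-1}, and C = −g Π G̃. -/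
open Matrix

/-- For any real `n×N` matrix `B`, the block matrix
`𝐀 = [[Iₙ, B], [−Πᵀ, I_N − Πᵀ B]]` is invertible, and the twisted higher
generalized metric factorizes through the open variables:
`𝐀ᵀ ⬝ diag(G⁻¹, G̃) ⬝ 𝐀 = 𝐚ᵀ ⬝ diag(g⁻¹, g̃) ⬝ 𝐚`, where
`𝐚 = [[Iₙ, B + C], [0, I_N]]`, `g = (G⁻¹ + Π G̃ Πᵀ)⁻¹`,
`g̃ = (G̃⁻¹ + Πᵀ G Π)⁻¹` and `C = −g Π G̃`. -/
theorem higher_generalized_metric_factorization {n N : ℕ} (hn : 0 < n) (hN : 0 < N)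
    (G : Matrix (Fin n) (Fin n) ℝ) (Gt : Matrix (Fin N) (Fin N) ℝ)
    (P B : Matrix (Fin n) (Fin N) ℝ) (hG : G.PosDef) (hGt : Gt.PosDef)
    (g : Matrix (Fin n) (Fin n) ℝ) (gt : Matrix (Fin N) (Fin N) ℝ)
    (C : Matrix (Fin n) (Fin N) ℝ)
    (hg : g = (G⁻¹ + P * Gt * Pᵀ)⁻¹) (hgt : gt = (Gt⁻¹ + Pᵀ * G * P)⁻¹)
    (hC : C = -(g * P * Gt))
    (A a : Matrix (Fin n ⊕ Fin N) (Fin n ⊕ Fin N) ℝ)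
    (hA : A = Matrix.fromBlocks 1 B (-Pᵀ) (1 - Pᵀ * B))
    (ha : a = Matrix.fromBlocks 1 (B + C) 0 1) :
    IsUnit A ∧
    Aᵀ * Matrix.fromBlocks G⁻¹ 0 0 Gt * A =
      aᵀ * Matrix.fromBlocks g⁻¹ 0 0 gt * a := by
  have hGs : Gᵀ = G := by simpa using hG.isHermitian.eq
  have hGts : Gtᵀ = Gt := by simpa using hGt.isHermitian.eq
  have hM : (G⁻¹ + P * Gt * Pᵀ).PosDef := by
    refine hG.inv.add_posSemidef ?_
    simpa using hGt.posSemidef.mul_mul_conjTranspose_same P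
  have hMs : (G⁻¹ + P * Gt * Pᵀ)ᵀ = G⁻¹ + P * Gt * Pᵀ := by simpa using hM.isHermitian.eq
  have hW : gt = Gt - Gt * Pᵀ * g * P * Gt := by
    have hu : IsUnit (G⁻¹ + P * (Gt⁻¹)⁻¹ * Pᵀ) := by
      rw [Matrix.nonsing_inv_nonsing_inv _ ((Matrix.isUnit_iff_isUnit_det _).1 hGt.isUnit)]
      exact hM.isUnit
    have := Matrix.add_mul_mul_inv_eq_sub Gt⁻¹ Pᵀ G P hGt.inv.isUnit hG.isUnit hu
    rw [Matrix.nonsing_inv_nonsing_inv _ ((Matrix.isUnit_iff_isUnit_det _).1 hGt.isUnit)] at this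
    rw [hgt, this, hg]
  have hMdet := (Matrix.isUnit_iff_isUnit_det _).1 hM.isUnit
  have hgi : g⁻¹ = G⁻¹ + P * Gt * Pᵀ := by
    rw [hg, Matrix.nonsing_inv_nonsing_inv _ hMdet]
  have hgM : (G⁻¹ + P * Gt * Pᵀ) * g = 1 := by
    rw [hg, Matrix.mul_nonsing_inv _ hMdet]
  have hgs : gᵀ = g := by
    rw [hg, Matrix.transpose_nonsing_inv, hMs]
  have hMg : g * (G⁻¹ + P * Gt * Pᵀ) = 1 := by
    rw [hg, Matrix.nonsing_inv_mul _ hMdet]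
  have hMC : (G⁻¹ + P * Gt * Pᵀ) * C = -(P * Gt) := by
    rw [hC, Matrix.mul_neg, Matrix.mul_assoc g, ← Matrix.mul_assoc _ g, hgM, Matrix.one_mul]
  have hCt : Cᵀ = -(Gt * Pᵀ * g) := by
    rw [hC]; simp [hgs, hGts, Matrix.mul_assoc]
  have hCM : Cᵀ * (G⁻¹ + P * Gt * Pᵀ) = -(Gt * Pᵀ) := by
    rw [hCt, Matrix.neg_mul, Matrix.mul_assoc, hMg, Matrix.mul_one]
  have hA' : A = fromBlocks 1 0 (-Pᵀ) 1 * fromBlocks 1 B 0 1 := by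
    rw [hA, fromBlocks_multiply]; simp [sub_eq_add_neg, add_comm]
  have ha' : a = fromBlocks 1 C 0 1 * fromBlocks 1 B 0 1 := by
    rw [ha, fromBlocks_multiply]; simp
  constructor
  · rw [Matrix.isUnit_iff_isUnit_det, hA', Matrix.det_mul]
    simp
  · have key : (fromBlocks 1 0 (-Pᵀ) 1)ᵀ * fromBlocks G⁻¹ 0 0 Gt * fromBlocks 1 0 (-Pᵀ) 1
        = (fromBlocks 1 C 0 1)ᵀ * fromBlocks g⁻¹ 0 0 gt * fromBlocks 1 C 0 1 := by
      rw [hgi]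
      simp only [fromBlocks_transpose, fromBlocks_multiply, Matrix.transpose_one,
        Matrix.transpose_zero, Matrix.one_mul, Matrix.mul_one, Matrix.zero_mul,
        Matrix.mul_zero, add_zero, zero_add, Matrix.transpose_neg, Matrix.transpose_transpose,
        hMC, hCM]
      congr 1
      · simp
      · simp
      · simp
      · rw [hW, hC]; simp [Matrix.mul_assoc]
    rw [hA', ha', Matrix.transpose_mul, Matrix.transpose_mul]
    calc _ = (fromBlocks 1 B 0 1)ᵀ * ((fromBlocks 1 0 (-Pᵀ) 1)ᵀ * fromBlocks G⁻¹ 0 0 Gt *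
            fromBlocks 1 0 (-Pᵀ) 1) * fromBlocks 1 B 0 1 := by simp only [Matrix.mul_assoc]
      _ = _ := by rw [key]; simp only [Matrix.mul_assoc]
end
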